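/- arXiv:1205.6487 — 4 statements merged into one kernel-verified Lean document; each statement's English description precedes it below -/
import Mathlib

section
/- Let G be a graph with n ≥ 6 vertices, e(G) edges, and diameter d ≥ 4. Then for every integer k with (3n − 4 + √(9n² − 24n + 16 + 8·e(G)·n² − 8n³))/(2n) ≤ k ≤ n, the inequality S_k(G) ≤ e(G) + C(k+1, 2) holds, where C(k+1,2) = (k+1)k/2 is the binomial coefficient. (This is Brouwer's conjectured bound, verified here for this range of k.) -/
open Polynomial

namespace LapPaper

variable {V : Type} [Fintype V] [DecidableEq V]

/-- The multiset of Laplacian eigenvalues of `G` (with multiplicity), given as the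
real roots of the characteristic polynomial of the Laplacian matrix `L = D - A`. -/
noncomputable def lapSpectrum (G : SimpleGraph V) [DecidableRel G.Adj] : Multiset ℝ :=
  (G.lapMatrix ℝ).charpoly.roots

/-- The average degree `d̄ = 2|E|/n` of a graph. -/
noncomputable def avgDeg (G : SimpleGraph V) [DecidableRel G.Adj] : ℝ :=
  2 * G.edgeFinset.card / Fintype.card V

/-- The Laplacian energy `LE(G) = ∑_i |μ_i - d̄|`. -/
noncomputable def LE (G : SimpleGraph V) [DecidableRel G.Adj] : ℝ :=
  ((lapSpectrum G).map (fun x => |x - avgDeg G|)).sum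

/-- `Sk G k` is the sum of the `k` largest Laplacian eigenvalues `μ_1 + ⋯ + μ_k` of `G`. -/
noncomputable def Sk (G : SimpleGraph V) [DecidableRel G.Adj] (k : ℕ) : ℝ :=
  ((((lapSpectrum G).sort (· ≤ ·)).reverse).take k).sum

/-- The number `σ` of Laplacian eigenvalues of `G` strictly larger than the average degree. -/
noncomputable def sigma (G : SimpleGraph V) [DecidableRel G.Adj] : ℕ :=
  Multiset.card ((lapSpectrum G).filter (fun x => avgDeg G < x))

/-- The double star `T(a,b)` on `a + b + 2` vertices: vertex `0` is adjacent to vertex `1`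
and to the `a` leaves `2, …, a+1`; vertex `1` is adjacent to the `b` leaves `a+2, …, a+b+1`. -/
def doubleStar (a b : ℕ) : SimpleGraph (Fin (a + b + 2)) :=
  SimpleGraph.fromRel (fun u v =>
    (u.1 = 0 ∧ v.1 = 1) ∨ (u.1 = 0 ∧ 2 ≤ v.1 ∧ v.1 < a + 2) ∨ (u.1 = 1 ∧ a + 2 ≤ v.1))

noncomputable instance (a b : ℕ) : DecidableRel (doubleStar a b).Adj := Classical.decRel _

/-- The star on `n` vertices: vertex `0` is adjacent to all other vertices. -/
def starGraph (n : ℕ) : SimpleGraph (Fin n) :=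
  SimpleGraph.fromRel (fun u _ => u.1 = 0)

noncomputable instance (n : ℕ) : DecidableRel (starGraph n).Adj := Classical.decRel _

end LapPaper

namespace LapPaper

variable {V : Type} [Fintype V] [DecidableEq V]

open Matrix in
/-- The quadratic form of a real Hermitian matrix in its eigenvector basis. -/
lemma dotProduct_mulVec_eq_sum_eigenvalues {A : Matrix V V ℝ} (hA : A.IsHermitian) (x : V → ℝ) :
    x ⬝ᵥ (A *ᵥ x) =
      ∑ j, hA.eigenvalues j * (x ⬝ᵥ ⇑(hA.eigenvectorBasis j)) ^ 2 := by
  have key : ∀ j, (A *ᵥ x) ⬝ᵥ ⇑(hA.eigenvectorBasis j) =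
      hA.eigenvalues j * (x ⬝ᵥ ⇑(hA.eigenvectorBasis j)) := by
    intro j
    have hT : Aᵀ = A := by simpa [IsHermitian, conjTranspose_eq_transpose_of_trivial] using hA
    rw [dotProduct_comm, dotProduct_mulVec, ← mulVec_transpose, hT, hA.mulVec_eigenvectorBasis,
      smul_dotProduct, smul_eq_mul, dotProduct_comm]
  have h := hA.eigenvectorBasis.sum_inner_mul_inner (WithLp.toLp 2 x) (WithLp.toLp 2 (A *ᵥ x))
  simp only [EuclideanSpace.inner_eq_star_dotProduct, star_trivial] at h
  rw [dotProduct_comm x, ← h]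
  refine Finset.sum_congr rfl fun j _ => ?_
  rw [key j, dotProduct_comm _ x]
  ring

open Matrix in
lemma dotProduct_self_eq_sum_eigenvectorBasis {A : Matrix V V ℝ} (hA : A.IsHermitian)
    (x : V → ℝ) :
    x ⬝ᵥ x = ∑ j, (x ⬝ᵥ ⇑(hA.eigenvectorBasis j)) ^ 2 := by
  have h := hA.eigenvectorBasis.sum_inner_mul_inner (WithLp.toLp 2 x) (WithLp.toLp 2 x)
  simp only [EuclideanSpace.inner_eq_star_dotProduct, star_trivial] at h
  rw [← h]
  refine Finset.sum_congr rfl fun j _ => ?_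
  rw [dotProduct_comm _ x]
  ring

open Matrix in
/-- Courant–Fischer lower bound: if the quadratic form of `A` is at least `t` times the squared
norm on the image of an injective linear map, then the `|ι|` largest eigenvalues of `A` are at
least `t`. -/
lemma le_eigenvalues₀_of_injective {A : Matrix V V ℝ} (hA : A.IsHermitian) {ι : Type*} [Fintype ι]
    (f : (ι → ℝ) →ₗ[ℝ] (V → ℝ)) (hf : Function.Injective f) (t : ℝ)
    (hft : ∀ y, t * (f y ⬝ᵥ f y) ≤ f y ⬝ᵥ (A *ᵥ f y))
    (i : Fin (Fintype.card V)) (hi : i.1 < Fintype.card ι) : t ≤ hA.eigenvalues₀ i := by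
  by_contra! hlt
  let e : Fin (Fintype.card V) ≃ V := Fintype.equivOfCardEq (Fintype.card_fin _)
  let b : Fin i.1 → V → ℝ := fun a => ⇑(hA.eigenvectorBasis (e ⟨a.1, a.2.trans i.2⟩))
  let g : (ι → ℝ) →ₗ[ℝ] (Fin i.1 → ℝ) :=
    { toFun := fun y a => f y ⬝ᵥ b a
      map_add' := fun y z => by ext a; simp [add_dotProduct]
      map_smul' := fun r y => by ext a; simp [smul_dotProduct] }
  have hker : LinearMap.ker g ≠ ⊥ := LinearMap.ker_ne_bot_of_finrank_lt (by simpa using hi)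
  obtain ⟨y, hy, hy0⟩ := (Submodule.ne_bot_iff _).mp hker
  have hfy : f y ≠ 0 := fun h => hy0 (hf (by rw [h, map_zero]))
  have hzero : ∀ j : V, (e.symm j).1 < i.1 → f y ⬝ᵥ ⇑(hA.eigenvectorBasis j) = 0 := by
    intro j hj
    have := congrFun (LinearMap.mem_ker.mp hy) ⟨_, hj⟩
    simpa [g, b] using this
  have hpos : 0 < f y ⬝ᵥ f y := by
    have := dotProduct_self_star_pos_iff.mpr hfy
    simpa using this
  have hle : f y ⬝ᵥ (A *ᵥ f y) ≤ hA.eigenvalues₀ i * (f y ⬝ᵥ f y) := by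
    rw [dotProduct_mulVec_eq_sum_eigenvalues hA, dotProduct_self_eq_sum_eigenvectorBasis hA,
      Finset.mul_sum]
    refine Finset.sum_le_sum fun j _ => ?_
    rcases lt_or_ge (e.symm j).1 i.1 with h | h
    · rw [hzero j h]; simp
    · exact mul_le_mul_of_nonneg_right (hA.eigenvalues₀_antitone h) (sq_nonneg _)
  nlinarith [hft y]

lemma Sk_eq_sum_eigenvalues₀ (G : SimpleGraph V) [DecidableRel G.Adj] (k : ℕ) :
    Sk G k = ∑ i : Fin (Fintype.card V) with i.1 < k,
      (G.isHermitian_lapMatrix ℝ).eigenvalues₀ i := by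
  have hsort : ((lapSpectrum G).sort (· ≤ ·)).reverse =
      List.ofFn (G.isHermitian_lapMatrix ℝ).eigenvalues₀ := by
    refine List.Perm.eq_of_sortedGE ?_
      (Matrix.IsHermitian.eigenvalues₀_antitone _).sortedGE_ofFn ?_
    · rw [List.sortedGE_reverse]
      exact (Multiset.pairwise_sort _ _).sortedLE
    · rw [← Multiset.coe_eq_coe, Multiset.coe_reverse, Multiset.sort_eq, lapSpectrum,
        (G.isHermitian_lapMatrix ℝ).roots_charpoly_eq_eigenvalues₀, Fin.univ_val_map]
      rfl
  rw [Sk, hsort, List.sum_take_ofFn]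

lemma sum_eigenvalues₀_lapMatrix (G : SimpleGraph V) [DecidableRel G.Adj] :
    ∑ i, (G.isHermitian_lapMatrix ℝ).eigenvalues₀ i = 2 * G.edgeFinset.card := by
  have h := (G.isHermitian_lapMatrix ℝ).trace_eq_sum_eigenvalues
  have ht : (G.lapMatrix ℝ).trace = 2 * G.edgeFinset.card := by
    have : ∑ v, (G.degree v : ℝ) = 2 * G.edgeFinset.card := by
      exact_mod_cast G.sum_degrees_eq_twice_card_edges
    rw [← this]
    simp [SimpleGraph.lapMatrix, SimpleGraph.degMatrix, Matrix.trace]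
  rw [← ht, h]
  exact ((Fintype.equivOfCardEq (Fintype.card_fin _)).symm.sum_comp _).symm

open Matrix in
lemma sum_sq_le_dotProduct_lapMatrix_mulVec (G : SimpleGraph V) [DecidableRel G.Adj]
    (s : Finset V) (h : V → V) (hs : ∀ v ∈ s, h v ∉ s ∧ G.Adj v (h v)) (x : V → ℝ) :
    ∑ v ∈ s, (x v - x (h v)) ^ 2 ≤ x ⬝ᵥ (G.lapMatrix ℝ *ᵥ x) := by
  let F : V → V → ℝ := fun i j => if G.Adj i j then (x i - x j) ^ 2 else 0
  have hF0 : ∀ i j, 0 ≤ F i j := fun i j => by simp only [F]; split_ifs <;> positivity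
  have hFs : ∀ i j, F i j = F j i := fun i j => by
    simp only [F, G.adj_comm i j, sub_sq_comm (x i) (x j)]
  have hform : x ⬝ᵥ (G.lapMatrix ℝ *ᵥ x) = (∑ i, ∑ j, F i j) / 2 := by
    rw [← G.lapMatrix_toLinearMap₂' ℝ x, toLinearMap₂'_apply']
  have h1 : ∑ v ∈ s, (x v - x (h v)) ^ 2 ≤ ∑ i ∈ s, ∑ j ∈ sᶜ, F i j := by
    refine Finset.sum_le_sum fun v hv => ?_
    obtain ⟨h1, h2⟩ := hs v hv
    calc (x v - x (h v)) ^ 2 = F v (h v) := by simp [F, h2]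
      _ ≤ _ := Finset.single_le_sum (f := F v) (fun j _ => hF0 v j) (by simpa using h1)
  have h2 : ∑ i ∈ s, ∑ j ∈ sᶜ, F i j = ∑ i ∈ sᶜ, ∑ j ∈ s, F i j := by
    rw [Finset.sum_comm]
    exact Finset.sum_congr rfl fun i _ => Finset.sum_congr rfl fun j _ => hFs _ _
  have h3 : ∑ i ∈ s, ∑ j ∈ sᶜ, F i j + ∑ i ∈ sᶜ, ∑ j ∈ s, F i j ≤ ∑ i, ∑ j, F i j := by
    rw [← Finset.sum_add_sum_compl s fun i => ∑ j, F i j]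
    have hsub : ∀ (r : Finset V) (i : V), ∑ j ∈ r, F i j ≤ ∑ j, F i j := fun r i =>
      Finset.sum_le_sum_of_subset_of_nonneg (Finset.subset_univ _) fun j _ _ => hF0 i j
    exact add_le_add (Finset.sum_le_sum fun i _ => hsub _ i)
      (Finset.sum_le_sum fun i _ => hsub _ i)
  rw [hform]
  linarith

/-- If every vertex outside `D` has a neighbour in `D`, all but `|D|` of the Laplacian
eigenvalues are at least `1`. -/
lemma one_le_eigenvalues₀_lapMatrix (G : SimpleGraph V) [DecidableRel G.Adj] (D : Finset V)
    (hD : ∀ v ∉ D, ∃ a ∈ D, G.Adj a v) (i : Fin (Fintype.card V))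
    (hi : i.1 < Fintype.card V - D.card) :
    1 ≤ (G.isHermitian_lapMatrix ℝ).eigenvalues₀ i := by
  let f : ((Dᶜ : Finset V) → ℝ) →ₗ[ℝ] (V → ℝ) :=
    { toFun := fun y v => if hv : v ∈ Dᶜ then y ⟨v, hv⟩ else 0
      map_add' := fun y z => by
        ext v
        by_cases hv : v ∈ Dᶜ
        · simp only [dif_pos hv, Pi.add_apply]
        · simp only [dif_neg hv, Pi.add_apply, add_zero]
      map_smul' := fun r y => by
        ext v
        by_cases hv : v ∈ Dᶜ
        · simp only [dif_pos hv, Pi.smul_apply, RingHom.id_apply]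
        · simp only [dif_neg hv, Pi.smul_apply, smul_zero] }
  have hfi : Function.Injective f := by
    intro y z hyz
    ext ⟨v, hv⟩
    simpa [f, Finset.mem_compl.mp hv] using congrFun hyz v
  refine le_eigenvalues₀_of_injective _ f hfi 1 (fun y => ?_) i
    (by rw [Fintype.card_coe, Finset.card_compl]; exact hi)
  have hD' : ∀ v : V, ∃ a, v ∉ D → a ∈ D ∧ G.Adj a v := fun v => by
    by_cases hv : v ∈ D
    · exact ⟨v, fun h => absurd hv h⟩
    · obtain ⟨a, ha⟩ := hD v hv
      exact ⟨a, fun _ => ha⟩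
  choose h hh using hD'
  have hzero : ∀ v ∈ D, f y v = 0 := fun v hv => by simp [f, hv]
  refine le_trans (le_of_eq ?_) (sum_sq_le_dotProduct_lapMatrix_mulVec G Dᶜ h
    (fun v hv => ?_) (f y))
  · rw [one_mul, dotProduct, ← Finset.sum_add_sum_compl D,
      Finset.sum_eq_zero fun v hv => by rw [hzero v hv, zero_mul], zero_add]
    refine Finset.sum_congr rfl fun v hv => ?_
    rw [hzero _ (hh v (Finset.mem_compl.mp hv)).1]
    ring
  · obtain ⟨h1, h2⟩ := hh v (Finset.mem_compl.mp hv)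
    exact ⟨by simpa using h1, h2.symm⟩

/-- If `G` has a matching from `D` to its complement, the `|D|` largest Laplacian eigenvalues are
at least `2`. -/
lemma two_le_eigenvalues₀_lapMatrix (G : SimpleGraph V) [DecidableRel G.Adj] (D : Finset V)
    (u : V → V) (hu : ∀ a ∈ D, u a ∉ D ∧ G.Adj a (u a)) (huinj : Set.InjOn u D)
    (i : Fin (Fintype.card V)) (hi : i.1 < D.card) :
    2 ≤ (G.isHermitian_lapMatrix ℝ).eigenvalues₀ i := by
  let f : (D → ℝ) →ₗ[ℝ] (V → ℝ) :=
    { toFun := fun y v => if hv : v ∈ D then y ⟨v, hv⟩ else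
        if hv : ∃ a : D, u a = v then - y hv.choose else 0
      map_add' := fun y z => by
        ext v
        by_cases hv : v ∈ D
        · simp [hv]
        · by_cases hv' : ∃ a : D, u a = v
          · simp only [hv, hv', dif_neg, not_false_iff, dif_pos, Pi.add_apply]; ring
          · simp only [hv, hv', dif_neg, not_false_iff, Pi.add_apply]; ring
      map_smul' := fun r y => by
        ext v
        by_cases hv : v ∈ D
        · simp [hv]
        · by_cases hv' : ∃ a : D, u a = v
          · simp only [hv, hv', dif_neg, not_false_iff, dif_pos, Pi.smul_apply, smul_neg,
              RingHom.id_apply]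
          · simp only [hv, hv', dif_neg, not_false_iff, Pi.smul_apply, smul_zero] }
  have hfD : ∀ y (a : D), f y a = y a := fun y a => by simp [f]
  have hfu : ∀ y (a : D), f y (u a) = - y a := fun y a => by
    have hex : ∃ b : D, u b = u a := ⟨a, rfl⟩
    have hch : hex.choose = a := Subtype.ext (huinj hex.choose.2 a.2 hex.choose_spec)
    simp only [f, LinearMap.coe_mk, AddHom.coe_mk, dif_neg (hu a a.2).1, dif_pos hex, hch]
  have hf0 : ∀ y v, v ∉ D → v ∉ D.image u → f y v = 0 := fun y v hv hv' => by
    have hex : ¬ ∃ a : D, u a = v := by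
      rintro ⟨a, rfl⟩
      exact hv' (Finset.mem_image_of_mem _ a.2)
    simp only [f, LinearMap.coe_mk, AddHom.coe_mk, dif_neg hv, dif_neg hex]
  have hfi : Function.Injective f := by
    intro y z hyz
    ext a
    rw [← hfD y, hyz, hfD z]
  refine le_eigenvalues₀_of_injective _ f hfi 2 (fun y => ?_) i (by rwa [Fintype.card_coe])
  refine le_trans (le_of_eq ?_) (sum_sq_le_dotProduct_lapMatrix_mulVec G D u hu (f y))
  have hneg : ∀ a ∈ D, f y (u a) = - f y a := fun a ha => by
    rw [hfu y ⟨a, ha⟩, hfD y ⟨a, ha⟩]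
  have hdisj : Disjoint D (D.image u) := by
    rw [Finset.disjoint_right]
    intro v hv
    obtain ⟨a, ha, rfl⟩ := Finset.mem_image.mp hv
    exact (hu a ha).1
  have hsum : f y ⬝ᵥ f y = ∑ v ∈ D, f y v * f y v + ∑ v ∈ D, f y v * f y v := by
    rw [dotProduct, ← Finset.sum_subset (Finset.subset_univ (D ∪ D.image u)) fun v _ hv => ?_,
      Finset.sum_union hdisj, Finset.sum_image huinj]
    · congr 1
      refine Finset.sum_congr rfl fun a ha => ?_
      rw [hneg a ha]
      ring
    · rw [Finset.mem_union, not_or] at hv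
      rw [hf0 y v hv.1 hv.2, zero_mul]
  rw [hsum, ← two_mul, ← mul_assoc, Finset.mul_sum]
  refine Finset.sum_congr rfl fun a ha => ?_
  rw [hneg a ha]
  ring

lemma sub_le_card_filter_fin (n k a : ℕ) (ha : a ≤ n) :
    a - k ≤ (Finset.univ.filter fun i : Fin n => k ≤ i.1 ∧ i.1 < a).card := by
  rw [← Nat.card_Ico k a]
  refine Finset.card_le_card_of_surjOn (fun i => i.1) fun j hj => ?_
  simp only [Finset.coe_Ico, Set.mem_Ico] at hj
  exact ⟨⟨j, hj.2.trans_le ha⟩, by simpa using hj, rfl⟩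

lemma two_mul_card_le_of_injOn_compl (D : Finset V) (u : V → V) (hu : ∀ a ∈ D, u a ∉ D)
    (huinj : Set.InjOn u D) : 2 * D.card ≤ Fintype.card V := by
  have := Finset.card_le_card_of_injOn u (t := Dᶜ)
    (fun a ha => by simpa using hu a ha) huinj
  rw [Finset.card_compl] at this
  have := D.card_le_univ
  omega

/-- A dominating set `D` matched into its complement bounds the sum of all but the `k` largest
Laplacian eigenvalues from below. -/
lemma Sk_add_le_of_dominating_of_matching (G : SimpleGraph V) [DecidableRel G.Adj]
    (D : Finset V) (hD : ∀ v ∉ D, ∃ a ∈ D, G.Adj a v)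
    (u : V → V) (hu : ∀ a ∈ D, u a ∉ D ∧ G.Adj a (u a)) (huinj : Set.InjOn u D) (k : ℕ) :
    Sk G k + ((Fintype.card V - D.card - k : ℕ) + (D.card - k : ℕ)) ≤ 2 * G.edgeFinset.card := by
  set ev := (G.isHermitian_lapMatrix ℝ).eigenvalues₀ with hev
  have hDle : 2 * D.card ≤ Fintype.card V :=
    two_mul_card_le_of_injOn_compl D u (fun a ha => (hu a ha).1) huinj
  have hpos : ∀ i, 0 ≤ ev i := fun i => by
    have h := (G.posSemidef_lapMatrix ℝ).eigenvalues_nonneg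
      ((Fintype.equivOfCardEq (Fintype.card_fin _)) i)
    simpa [Matrix.IsHermitian.eigenvalues, hev] using h
  have hlow : ∀ i, (if i.1 < Fintype.card V - D.card then (1 : ℝ) else 0) +
      (if i.1 < D.card then (1 : ℝ) else 0) ≤ ev i := by
    intro i
    split_ifs with h1 h2 h2
    · linarith [two_le_eigenvalues₀_lapMatrix G D u hu huinj i h2]
    · linarith [one_le_eigenvalues₀_lapMatrix G D hD i h1]
    · omega
    · linarith [hpos i]
  rw [← sum_eigenvalues₀_lapMatrix, Sk_eq_sum_eigenvalues₀,
    ← Finset.sum_filter_add_sum_filter_not Finset.univ (fun i : Fin (Fintype.card V) => i.1 < k)]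
  gcongr
  refine le_trans ?_ (Finset.sum_le_sum fun i _ => hlow i)
  rw [Finset.sum_add_distrib, Finset.sum_boole, Finset.sum_boole]
  simp only [Finset.filter_filter, not_lt]
  gcongr
  · exact sub_le_card_filter_fin _ _ _ (Nat.sub_le _ _)
  · exact sub_le_card_filter_fin _ _ _ D.card_le_univ

/-- In a graph without isolated vertices there is a minimum dominating set each of whose vertices
has a private neighbour outside the set (Bollobás–Cockayne). -/
lemma exists_minimum_dominating_private (G : SimpleGraph V) [DecidableRel G.Adj]
    (hiso : ∀ v, ∃ w, G.Adj v w) :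
    ∃ D : Finset V, (∀ v ∉ D, ∃ a ∈ D, G.Adj a v) ∧
      (∀ D' : Finset V, (∀ v ∉ D', ∃ a ∈ D', G.Adj a v) → D.card ≤ D'.card) ∧
      ∀ a ∈ D, ∃ u, u ∉ D ∧ G.Adj a u ∧ ∀ b ∈ D, G.Adj b u → b = a := by
  let dom : Finset (Finset V) := Finset.univ.filter fun D => ∀ v ∉ D, ∃ a ∈ D, G.Adj a v
  obtain ⟨D₀, hD₀, hmin₀⟩ := dom.exists_min_image Finset.card ⟨Finset.univ, by simp [dom]⟩
  let minDom := dom.filter fun D => D.card = D₀.card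
  let inner : Finset V → Finset (V × V) := fun D => (D ×ˢ D).filter fun p => G.Adj p.1 p.2
  obtain ⟨D, hD, hmax⟩ := minDom.exists_max_image (fun D => (inner D).card)
    ⟨D₀, by simp [minDom, hD₀]⟩
  simp only [minDom, Finset.mem_filter] at hD
  have hDdom : ∀ v ∉ D, ∃ a ∈ D, G.Adj a v := by simpa [dom] using hD.1
  have hmin : ∀ D' : Finset V, (∀ v ∉ D', ∃ a ∈ D', G.Adj a v) → D.card ≤ D'.card :=
    fun D' h => hD.2 ▸ hmin₀ D' (by simpa [dom] using h)
  refine ⟨D, hDdom, hmin, fun a ha => ?_⟩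
  by_contra! hpriv
  have hother : ∀ v ∉ D, ∃ b ∈ D, G.Adj b v ∧ b ≠ a := by
    intro v hv
    obtain ⟨b, hb, hbv⟩ := hDdom v hv
    by_cases hba : b = a
    · exact hpriv v hv (hba ▸ hbv)
    · exact ⟨b, hb, hbv, hba⟩
  have hisol : ∀ b ∈ D, ¬ G.Adj a b := by
    intro b hb hab
    have := hmin (D.erase a) fun v hv => by
      by_cases hva : v = a
      · subst hva
        exact ⟨b, Finset.mem_erase.mpr ⟨hab.ne', hb⟩, hab.symm⟩
      · obtain ⟨c, hc, hcv, hca⟩ := hother v fun h => hv (Finset.mem_erase.mpr ⟨hva, h⟩)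
        exact ⟨c, Finset.mem_erase.mpr ⟨hca, hc⟩, hcv⟩
    have := Finset.card_erase_lt_of_mem ha
    omega
  obtain ⟨w, haw⟩ := hiso a
  have hwD : w ∉ D := fun h => hisol w h haw
  obtain ⟨b, hb, hbw, hba⟩ := hother w hwD
  have hw' : w ∉ D.erase a := fun h => hwD (Finset.mem_of_mem_erase h)
  have hcard : (insert w (D.erase a)).card = D.card := by
    rw [Finset.card_insert_of_notMem hw', Finset.card_erase_add_one ha]
  have hle := hmax (insert w (D.erase a)) (by
    simp only [minDom, dom, Finset.mem_filter, Finset.mem_univ, true_and]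
    refine ⟨fun v hv => ?_, hcard.trans hD.2⟩
    rw [Finset.mem_insert, not_or, Finset.mem_erase, not_and] at hv
    by_cases hva : v = a
    · exact ⟨w, Finset.mem_insert_self _ _, hva ▸ haw.symm⟩
    · obtain ⟨c, hc, hcv, hca⟩ := hother v (hv.2 hva)
      exact ⟨c, Finset.mem_insert_of_mem (Finset.mem_erase.mpr ⟨hca, hc⟩), hcv⟩)
  have hlt : (inner D).card < (inner (insert w (D.erase a))).card := by
    refine Finset.card_lt_card (Finset.ssubset_iff_of_subset ?_ |>.mpr ⟨(w, b), ?_, ?_⟩)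
    · rintro ⟨x, y⟩ hxy
      simp only [inner, Finset.mem_filter, Finset.mem_product, Finset.mem_insert,
        Finset.mem_erase] at hxy ⊢
      obtain ⟨⟨hx, hy⟩, hadj⟩ := hxy
      have hxa : x ≠ a := by rintro rfl; exact hisol y hy hadj
      have hya : y ≠ a := by rintro rfl; exact hisol x hx hadj.symm
      exact ⟨⟨Or.inr ⟨hxa, hx⟩, Or.inr ⟨hya, hy⟩⟩, hadj⟩
    · simp only [inner, Finset.mem_filter, Finset.mem_product, Finset.mem_insert,
        Finset.mem_erase]
      exact ⟨⟨Or.inl trivial, Or.inr ⟨hba, hb⟩⟩, hbw.symm⟩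
    · simp [inner, hwD]
  omega

/-- A graph on `2k ≥ 6` vertices whose vertices split into a minimum dominating set `D` of size
`k` and private neighbours of the vertices of `D` has at most `k(k+1)/2` edges. -/
lemma two_mul_card_edgeFinset_le_of_minimum_dominating (G : SimpleGraph V) [DecidableRel G.Adj]
    (k : ℕ) (hk : 3 ≤ k) (hV : Fintype.card V = 2 * k) (D : Finset V) (hDk : D.card = k)
    (hmin : ∀ D' : Finset V, (∀ v ∉ D', ∃ a ∈ D', G.Adj a v) → D.card ≤ D'.card)
    (u : V → V) (hu : ∀ a ∈ D, u a ∉ D ∧ G.Adj a (u a) ∧ ∀ b ∈ D, G.Adj b (u a) → b = a) :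
    2 * G.edgeFinset.card ≤ k * (k + 1) := by
  have huinj : Set.InjOn u D := fun a ha b hb hab =>
    (hu b hb).2.2 a ha (hab ▸ (hu a ha).2.1)
  have himage : D.image u = Dᶜ := by
    refine Finset.eq_of_subset_of_card_le (fun v hv => ?_) ?_
    · obtain ⟨a, ha, rfl⟩ := Finset.mem_image.mp hv
      exact Finset.mem_compl.mpr (hu a ha).1
    · rw [Finset.card_image_of_injOn huinj, Finset.card_compl]
      omega
  have hout : ∀ v ∉ D, ∃ a ∈ D, u a = v := fun v hv =>
    Finset.mem_image.mp (himage ▸ Finset.mem_compl.mpr hv)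
  let A : V → Finset V := fun a => D.filter fun b => G.Adj a b
  let B : V → Finset V := fun a => D.filter fun b => G.Adj (u a) (u b)
  have hA : ∀ a ∈ D, G.degree a ≤ (A a).card + 1 := by
    intro a ha
    rw [← G.card_neighborFinset_eq_degree]
    refine (Finset.card_le_card (t := insert (u a) (A a)) fun w hw => ?_).trans
      (Finset.card_insert_le _ _)
    rw [SimpleGraph.mem_neighborFinset] at hw
    by_cases hwD : w ∈ D
    · exact Finset.mem_insert_of_mem (Finset.mem_filter.mpr ⟨hwD, hw⟩)
    · obtain ⟨b, hb, rfl⟩ := hout w hwD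
      rw [(hu b hb).2.2 a ha hw]
      exact Finset.mem_insert_self _ _
  have hB : ∀ a ∈ D, G.degree (u a) ≤ (B a).card + 1 := by
    intro a ha
    rw [← G.card_neighborFinset_eq_degree]
    refine (Finset.card_le_card (t := insert a ((B a).image u)) fun w hw => ?_).trans
      ((Finset.card_insert_le _ _).trans (Nat.add_le_add_right Finset.card_image_le 1))
    rw [SimpleGraph.mem_neighborFinset] at hw
    by_cases hwD : w ∈ D
    · rw [(hu a ha).2.2 w hwD hw.symm]
      exact Finset.mem_insert_self _ _
    · obtain ⟨b, hb, rfl⟩ := hout w hwD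
      exact Finset.mem_insert_of_mem
        (Finset.mem_image_of_mem _ (Finset.mem_filter.mpr ⟨hb, hw⟩))
  have heq : ∀ a ∈ D, ∀ b ∈ A a, ∀ c ∈ B a, b = c := by
    intro a ha b hb c hc
    by_contra hbc
    simp only [A, B, Finset.mem_filter] at hb hc
    have hac : a ≠ c := by rintro rfl; exact G.irrefl hc.2
    have hcard : (insert (u c) ((D.erase a).erase c)).card < D.card := by
      have h1 := Finset.card_insert_le (u c) ((D.erase a).erase c)
      rw [Finset.card_erase_of_mem (Finset.mem_erase.mpr ⟨hac.symm, hc.1⟩),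
        Finset.card_erase_of_mem ha] at h1
      omega
    refine absurd (hmin _ fun v hv => ?_) (not_le.mpr hcard)
    have hself : u c ∈ insert (u c) ((D.erase a).erase c) := Finset.mem_insert_self _ _
    have hmem : ∀ d ∈ D, d ≠ a → d ≠ c → d ∈ insert (u c) ((D.erase a).erase c) :=
      fun d hd h1 h2 =>
        Finset.mem_insert_of_mem (Finset.mem_erase.mpr ⟨h2, Finset.mem_erase.mpr ⟨h1, hd⟩⟩)
    by_cases hvD : v ∈ D
    · by_cases hva : v = a
      · exact ⟨b, hmem b hb.1 (hva ▸ hb.2.ne' ∘ fun h => h.trans hva) hbc, hva ▸ hb.2.symm⟩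
      · by_cases hvc : v = c
        · exact ⟨u c, hself, hvc ▸ (hu c hc.1).2.1.symm⟩
        · exact absurd (hmem v hvD hva hvc) hv
    · obtain ⟨d, hd, rfl⟩ := hout v hvD
      by_cases hda : d = a
      · exact ⟨u c, hself, hda ▸ hc.2.symm⟩
      · by_cases hdc : d = c
        · exact absurd (hdc ▸ hself) hv
        · exact ⟨d, hmem d hd hda hdc, (hu d hd).2.1⟩
  have hAB : ∀ a ∈ D, (A a).card + (B a).card ≤ k - 1 := by
    intro a ha
    have hA' : (A a).card ≤ k - 1 := by
      rw [← hDk, ← Finset.card_erase_of_mem ha]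
      refine Finset.card_le_card fun b hb => ?_
      obtain ⟨h1, h2⟩ := Finset.mem_filter.mp hb
      exact Finset.mem_erase.mpr ⟨h2.ne', h1⟩
    have hB' : (B a).card ≤ k - 1 := by
      rw [← hDk, ← Finset.card_erase_of_mem ha]
      refine Finset.card_le_card fun b hb => ?_
      obtain ⟨h1, h2⟩ := Finset.mem_filter.mp hb
      refine Finset.mem_erase.mpr ⟨?_, h1⟩
      rintro rfl
      exact G.irrefl h2
    rcases (A a).eq_empty_or_nonempty with hAe | ⟨b, hb⟩
    · rw [hAe, Finset.card_empty, zero_add]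
      exact hB'
    rcases (B a).eq_empty_or_nonempty with hBe | ⟨c, hc⟩
    · rw [hBe, Finset.card_empty, add_zero]
      exact hA'
    have h1 : (A a).card ≤ 1 := Finset.card_le_one.mpr fun x hx y hy =>
      (heq a ha x hx c hc).trans (heq a ha y hy c hc).symm
    have h2 : (B a).card ≤ 1 := Finset.card_le_one.mpr fun x hx y hy =>
      (heq a ha b hb x hx).symm.trans (heq a ha b hb y hy)
    omega
  rw [← G.sum_degrees_eq_twice_card_edges, ← Finset.sum_add_sum_compl D, ← himage,
    Finset.sum_image huinj, ← Finset.sum_add_distrib]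
  refine (Finset.sum_le_card_nsmul D _ (k + 1) fun a ha => ?_).trans (by rw [hDk, smul_eq_mul])
  have := hA a ha
  have := hB a ha
  have := hAB a ha
  omega

/-- The spectral hypothesis on `k`, freed of the square root and of division. -/
lemma two_mul_mul_le_of_root_le (n k m : ℝ) (hn : 0 < n)
    (h : (3 * n - 4 + Real.sqrt (9 * n ^ 2 - 24 * n + 16 + 8 * m * n ^ 2 - 8 * n ^ 3)) / (2 * n)
      ≤ k) :
    2 * m * n ≤ n * (k ^ 2 - 3 * k + 2 * n) + 4 * k := by
  rw [div_le_iff₀ (by positivity)] at h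
  set Δ := 9 * n ^ 2 - 24 * n + 16 + 8 * m * n ^ 2 - 8 * n ^ 3 with hΔ
  have h1 : Δ ≤ (k * (2 * n) - (3 * n - 4)) ^ 2 :=
    (Real.sqrt_le_left (by linarith [Real.sqrt_nonneg Δ])).mp (by linarith)
  have h2 : 4 * n * (2 * m * n) ≤ 4 * n * (n * (k ^ 2 - 3 * k + 2 * n) + 4 * k) := by
    rw [hΔ] at h1
    linarith
  exact le_of_mul_le_mul_left h2 (by positivity)

/-- For a graph `G` with `n ≥ 6` vertices and diameter `d ≥ 4`,
Brouwer's conjectured bound `S_k(G) ≤ e(G) + (k+1 choose 2)` holds whenever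
`(3n - 4 + √(9n² - 24n + 16 + 8 e(G) n² - 8n³))/(2n) ≤ k ≤ n`. -/
theorem brouwer_of_diam_ge_four {V : Type} [Fintype V] [DecidableEq V]
    (G : SimpleGraph V) [DecidableRel G.Adj] (n : ℕ) (hcard : Fintype.card V = n)
    (hn : 6 ≤ n) (hconn : G.Connected) (hdiam : 4 ≤ G.diam)
    (k : ℕ) (hkn : k ≤ n)
    (hk_lb : (3 * (n : ℝ) - 4 +
        Real.sqrt (9 * (n : ℝ) ^ 2 - 24 * n + 16 + 8 * G.edgeFinset.card * n ^ 2 - 8 * n ^ 3)) /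
        (2 * n) ≤ (k : ℝ)) :
    Sk G k ≤ (G.edgeFinset.card : ℝ) + ((k + 1).choose 2 : ℕ) := by
  have hiso : ∀ v, ∃ w, G.Adj v w := by
    have : Nontrivial V := Fintype.one_lt_card_iff_nontrivial.mp (by omega)
    intro v
    exact hconn.preconnected.exists_adj_of_nontrivial v
  obtain ⟨D, hdom, hmin, hpriv⟩ := exists_minimum_dominating_private G hiso
  choose! u hu using hpriv
  have huinj : Set.InjOn u D := fun a ha b hb hab =>
    (hu b hb).2.2 a ha (hab ▸ (hu a ha).2.1)
  have hS := Sk_add_le_of_dominating_of_matching G D hdom u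
    (fun a ha => ⟨(hu a ha).1, (hu a ha).2.1⟩) huinj k
  have hC : 2 * (k + 1).choose 2 = k * (k + 1) := by
    rw [Nat.choose_two_right, Nat.mul_div_cancel' (Nat.even_mul_pred_self _).two_dvd,
      Nat.add_sub_cancel, mul_comm]
  have hq := two_mul_mul_le_of_root_le n k G.edgeFinset.card (by positivity) hk_lb
  have hD2k : 2 * k = n → k ≤ D.card → 2 * G.edgeFinset.card ≤ k * (k + 1) := by
    intro h2k hkD
    refine two_mul_card_edgeFinset_le_of_minimum_dominating G k (by omega) (by omega) D
      (le_antisymm ?_ hkD) hmin u hu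
    have := two_mul_card_le_of_injOn_compl D u (fun a ha => (hu a ha).1) huinj
    omega
  generalize G.edgeFinset.card = m at *
  generalize (k + 1).choose 2 = C at *
  have hmq : (m : ℤ) * n ≤ n * (C - 2 * k + n) + 2 * k := by
    have hC' : (2 : ℝ) * C = k * (k + 1) := by exact_mod_cast hC
    have : (m : ℝ) * n ≤ n * (C - 2 * k + n) + 2 * k := by
      have : (n : ℝ) * (2 * C) = n * (k * (k + 1)) := by rw [hC']
      linarith
    exact_mod_cast this
  suffices h : m ≤ C + ((Fintype.card V - D.card - k) + (D.card - k)) by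
    have : (m : ℝ) ≤ C + (((Fintype.card V - D.card - k : ℕ) : ℝ) + (D.card - k : ℕ)) := by
      exact_mod_cast h
    linarith
  rw [hcard]
  rcases lt_trichotomy (2 * k) n with h | h | h
  · have : (m : ℤ) < C - 2 * k + n + 1 := by
      zify at h
      nlinarith
    omega
  · rcases lt_or_ge D.card k with hDk | hDk
    · have : (m : ℤ) < C + 2 := by
        zify at h hn
        nlinarith
      omega
    · have := hD2k h hDk
      omega
  · have : (m : ℤ) < C + 1 := by
      zify at h hn
      nlinarith [mul_pos (show (0 : ℤ) < n - 1 by omega) (show (0 : ℤ) < 2 * k - n by omega)]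
    omega

end LapPaper
end

section
/- Let n ≥ 16 and k = ⌊n/3⌋. Then LE(F(n,k)) > LE(T(n−3, 1)), where F(n,k) is the tree with n vertices and diameter 4 consisting of a central vertex adjacent to n − 2k − 1 leaves and to two vertices of degree k, each of which is adjacent to k − 1 leaves, and T(n−3, 1) is the double star on n vertices. In particular, for every n ≥ 16 there is an n-vertex tree of diameter 4 whose Laplacian energy exceeds that of some n-vertex tree of diameter 3. -/
open Polynomial

namespace LapPaper

/-- The tree `F(n,k)` with `n` vertices and diameter 4: the central vertex `0` is adjacent
to the two vertices `1` and `2` and to the `n - 2k - 1` leaves `2k+1, …, n-1`; vertex `1`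
is adjacent to the `k - 1` leaves `3, …, k+1`, and vertex `2` is adjacent to the `k - 1`
leaves `k+2, …, 2k` (so vertices `1` and `2` both have degree `k`). -/
def Ftree (n k : ℕ) : SimpleGraph (Fin n) :=
  SimpleGraph.fromRel (fun u v =>
    (u.1 = 0 ∧ v.1 = 1) ∨ (u.1 = 0 ∧ v.1 = 2) ∨
    (u.1 = 1 ∧ 3 ≤ v.1 ∧ v.1 < k + 2) ∨
    (u.1 = 2 ∧ k + 2 ≤ v.1 ∧ v.1 < 2 * k + 1) ∨
    (u.1 = 0 ∧ 2 * k + 1 ≤ v.1))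

noncomputable instance (n k : ℕ) : DecidableRel (Ftree n k).Adj := Classical.decRel _

section Pendant

open Matrix

variable {V H L : Type} [Fintype V] [DecidableEq V] [Fintype H] [DecidableEq H]
  [Fintype L] [DecidableEq L]

/-- The Laplacian of a graph obtained from `K` by attaching pendant vertices `l : L`
at `f l`, in block form. -/
theorem lapMatrix_submatrix_eq_fromBlocks (G : SimpleGraph V) [DecidableRel G.Adj]
    (K : SimpleGraph H) [DecidableRel K.Adj] (e : H ⊕ L ≃ V) (f : L → H)
    (hHH : ∀ i j, G.Adj (e (.inl i)) (e (.inl j)) ↔ K.Adj i j)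
    (hHL : ∀ i l, G.Adj (e (.inl i)) (e (.inr l)) ↔ f l = i)
    (hLL : ∀ l l', ¬ G.Adj (e (.inr l)) (e (.inr l'))) :
    (G.lapMatrix ℝ).submatrix e e =
      fromBlocks (K.lapMatrix ℝ + diagonal fun i => ((Finset.univ.filter (f · = i)).card : ℝ))
        (of fun i l => if f l = i then -1 else 0) (of fun l i => if f l = i then -1 else 0) 1 := by
  have hLH : ∀ l i, G.Adj (e (.inr l)) (e (.inl i)) ↔ f l = i := fun l i => by
    rw [G.adj_comm, hHL]
  have hdeg : ∀ v, (G.degree v : ℝ) = (∑ i, if G.Adj v (e (.inl i)) then 1 else 0) +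
      ∑ l, if G.Adj v (e (.inr l)) then 1 else 0 := fun v => by
    rw [G.degree_eq_sum_if_adj, ← e.sum_comp, Fintype.sum_sum_type]
  ext s t
  rcases s with i | l <;> rcases t with j | l'
  · by_cases h : i = j
    · subst h
      simp [SimpleGraph.lapMatrix, SimpleGraph.degMatrix, hdeg, hHH, hHL,
        K.degree_eq_sum_if_adj]
    · simp [SimpleGraph.lapMatrix, SimpleGraph.degMatrix, hHH, h, SimpleGraph.adjMatrix_apply]
  · simp [SimpleGraph.lapMatrix, SimpleGraph.degMatrix, hHL, SimpleGraph.adjMatrix_apply]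
    split_ifs <;> simp
  · simp [SimpleGraph.lapMatrix, SimpleGraph.degMatrix, hLH, SimpleGraph.adjMatrix_apply]
    split_ifs <;> simp
  · by_cases h : l = l'
    · subst h
      simp [SimpleGraph.lapMatrix, SimpleGraph.degMatrix, hdeg, hLH, hLL, Finset.filter_eq]
    · simp [SimpleGraph.lapMatrix, SimpleGraph.degMatrix, hLL, h, SimpleGraph.adjMatrix_apply]

theorem det_sub_lapMatrix_of_pendant {G : SimpleGraph V} [DecidableRel G.Adj]
    {K : SimpleGraph H} [DecidableRel K.Adj] {e : H ⊕ L ≃ V} {f : L → H}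
    (hHH : ∀ i j, G.Adj (e (.inl i)) (e (.inl j)) ↔ K.Adj i j)
    (hHL : ∀ i l, G.Adj (e (.inl i)) (e (.inr l)) ↔ f l = i)
    (hLL : ∀ l l', ¬ G.Adj (e (.inr l)) (e (.inr l'))) {x : ℝ} (hx : x ≠ 1) :
    (G.lapMatrix ℝ).charpoly.eval x = (x - 1) ^ Fintype.card L *
      (diagonal (fun i => x - (Finset.univ.filter (f · = i)).card * (x / (x - 1))) -
        K.lapMatrix ℝ).det := by
  have hx' : x - 1 ≠ 0 := sub_ne_zero.mpr hx
  rw [eval_charpoly, ← det_submatrix_equiv_self e]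
  have h1 : (scalar V x - G.lapMatrix ℝ).submatrix e e =
      scalar (H ⊕ L) x - (G.lapMatrix ℝ).submatrix e e := by
    ext s t
    simp [diagonal_apply]
  have h2 : (scalar (H ⊕ L) x : Matrix _ _ ℝ) = fromBlocks (scalar H x) 0 0 (scalar L x) := by
    ext (s | s) (t | t) <;> simp [diagonal_apply]
  rw [h1, h2, lapMatrix_submatrix_eq_fromBlocks G K e f hHH hHL hLL, sub_eq_add_neg,
    fromBlocks_neg, fromBlocks_add]
  have h3 : scalar L x + -1 = diagonal fun _ : L => x - 1 := by
    ext s t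
    by_cases h : s = t <;> simp [h, sub_eq_add_neg]
  rw [h3]
  let _i : Invertible (diagonal fun _ : L => x - 1) :=
    ⟨diagonal fun _ => (x - 1)⁻¹, by simp [hx'], by simp [hx']⟩
  have h4 : ⅟(diagonal fun _ : L => x - 1) = diagonal fun _ => (x - 1)⁻¹ :=
    invOf_eq_right_inv (by simp [hx'])
  rw [det_fromBlocks₂₂, det_diagonal, Finset.prod_const, Finset.card_univ, h4]
  congr 2
  ext i j
  rw [Matrix.sub_apply, Matrix.mul_apply]
  simp only [mul_diagonal]
  by_cases h : i = j
  · subst h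
    simp [Finset.sum_ite, Finset.filter_filter]
    field_simp
    ring
  · have : ∀ l, ¬ (f l = i ∧ f l = j) := fun l hl => h (hl.1.symm.trans hl.2)
    simp [h]
    refine Finset.sum_eq_zero fun l _ => ?_
    have := this l
    split_ifs <;> simp_all

theorem card_edgeFinset_of_pendant {G : SimpleGraph V} [DecidableRel G.Adj]
    {K : SimpleGraph H} [DecidableRel K.Adj] {e : H ⊕ L ≃ V} {f : L → H}
    (hHH : ∀ i j, G.Adj (e (.inl i)) (e (.inl j)) ↔ K.Adj i j)
    (hHL : ∀ i l, G.Adj (e (.inl i)) (e (.inr l)) ↔ f l = i)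
    (hLL : ∀ l l', ¬ G.Adj (e (.inr l)) (e (.inr l'))) :
    2 * (G.edgeFinset.card : ℝ) = (K.lapMatrix ℝ).trace + 2 * Fintype.card L := by
  have h1 : ((G.lapMatrix ℝ).submatrix e e).trace = 2 * (G.edgeFinset.card : ℝ) := by
    have h := G.sum_degrees_eq_twice_card_edges
    rw [← e.sum_comp] at h
    have h' := congrArg (Nat.cast (R := ℝ)) h
    push_cast at h'
    rw [← h']
    simp [Matrix.trace, SimpleGraph.lapMatrix, SimpleGraph.degMatrix]
  rw [← h1, lapMatrix_submatrix_eq_fromBlocks G K e f hHH hHL hLL, trace, Fintype.sum_sum_type]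
  simp only [diag_apply, fromBlocks_apply₁₁, fromBlocks_apply₂₂, Matrix.add_apply, diagonal_apply_eq,
    one_apply_eq, Finset.sum_add_distrib, Finset.sum_const, nsmul_eq_mul, mul_one]
  rw [trace, ← Nat.cast_sum,
    ← Finset.card_eq_sum_card_fiberwise (fun l _ => Finset.mem_univ (f l)), Finset.card_univ]
  simp only [diag_apply]
  ring

end Pendant

theorem lapSpectrum_eq_of_eval_charpoly {V : Type} [Fintype V] [DecidableEq V]
    (G : SimpleGraph V) [DecidableRel G.Adj] (s : Multiset ℝ)
    (h : ∀ x ≠ 1, (G.lapMatrix ℝ).charpoly.eval x = (s.map fun a => x - a).prod) :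
    lapSpectrum G = s := by
  have : (G.lapMatrix ℝ).charpoly = (s.map fun a => X - C a).prod := by
    refine eq_of_infinite_eval_eq _ _ ((Set.finite_singleton (1 : ℝ)).infinite_compl.mono ?_)
    intro x hx
    rw [Set.mem_ofPred_eq, h x hx, eval_multiset_prod, Multiset.map_map]
    simp
  rw [lapSpectrum, this, roots_multiset_prod_X_sub_C]

theorem card_filter_fin_eq {m a b : ℕ} (hb : b ≤ m) (p : Fin m → Prop) [DecidablePred p]
    (hp : ∀ j, p j ↔ a ≤ j.1 ∧ j.1 < b) : (Finset.univ.filter p).card = b - a := by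
  rw [← Nat.card_Ico, ← Finset.card_map Fin.valEmbedding]
  congr 1
  ext i
  simp only [Finset.mem_map, Finset.mem_filter, Finset.mem_univ, true_and, hp,
    Fin.valEmbedding_apply, Finset.mem_Ico]
  exact ⟨by rintro ⟨j, hj, rfl⟩; exact hj, fun hi => ⟨⟨i, by omega⟩, hi, rfl⟩⟩

/-- A monic real cubic with alternating signs at five points splits, with located roots. -/
theorem exists_cubic_factorization {p q r x₀ x₁ x₂ x₃ x₄ : ℝ} (h₀₁ : x₀ < x₁) (h₁₂ : x₁ ≤ x₂)
    (h₂₃ : x₂ < x₃) (h₃₄ : x₃ < x₄) (h₀ : x₀ ^ 3 - p * x₀ ^ 2 + q * x₀ - r < 0)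
    (h₁ : 0 < x₁ ^ 3 - p * x₁ ^ 2 + q * x₁ - r) (h₂ : 0 < x₂ ^ 3 - p * x₂ ^ 2 + q * x₂ - r)
    (h₃ : x₃ ^ 3 - p * x₃ ^ 2 + q * x₃ - r < 0) (h₄ : 0 < x₄ ^ 3 - p * x₄ ^ 2 + q * x₄ - r) :
    ∃ a b c, a ∈ Set.Ioo x₀ x₁ ∧ b ∈ Set.Ioo x₂ x₃ ∧ c ∈ Set.Ioo x₃ x₄ ∧ a + b + c = p ∧
      ∀ x : ℝ, x ^ 3 - p * x ^ 2 + q * x - r = (x - a) * (x - b) * (x - c) := by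
  have hc : ∀ s, ContinuousOn (fun x : ℝ => x ^ 3 - p * x ^ 2 + q * x - r) s :=
    fun s => by fun_prop
  obtain ⟨a, ha, ha'⟩ := intermediate_value_Ioo h₀₁.le (hc _) ⟨h₀, h₁⟩
  obtain ⟨b, hb, hb'⟩ := intermediate_value_Ioo' h₂₃.le (hc _) ⟨h₃, h₂⟩
  obtain ⟨c, hcc, hc'⟩ := intermediate_value_Ioo h₃₄.le (hc _) ⟨h₃, h₄⟩
  simp only at ha' hb' hc'
  have hab : a - b ≠ 0 := by linarith [ha.2, hb.1]
  have hac : a - c ≠ 0 := by linarith [ha.2, hcc.1]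
  have hbc : b - c ≠ 0 := by linarith [hb.2, hcc.1]
  have e₁ : a ^ 2 + a * b + b ^ 2 - p * (a + b) + q = 0 :=
    mul_left_cancel₀ hab (by linear_combination ha' - hb')
  have e₂ : a ^ 2 + a * c + c ^ 2 - p * (a + c) + q = 0 :=
    mul_left_cancel₀ hac (by linear_combination ha' - hc')
  have hp : a + b + c = p := by
    have : a + b + c - p = 0 := mul_left_cancel₀ hbc (by linear_combination e₁ - e₂)
    linarith
  refine ⟨a, b, c, ha, hb, hcc, hp, fun x => ?_⟩
  subst hp
  linear_combination (x - a) * e₁ + ha'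

theorem lapSpectrum_doubleStar (m : ℕ) {a b c : ℝ}
    (h : ∀ x : ℝ, x ^ 3 - (m + 5) * x ^ 2 + (3 * m + 7) * x - (m + 3) =
      (x - a) * (x - b) * (x - c)) (hm : 1 ≤ m) :
    lapSpectrum (doubleStar m 1) = Multiset.replicate (m - 1) 1 + {0, a, b, c} ∧
      avgDeg (doubleStar m 1) = 2 - 2 / (m + 3) := by
  let e : Fin 2 ⊕ Fin (m + 1) ≃ Fin (m + 1 + 2) :=
    finSumFinEquiv.trans (finCongr (by omega))
  let f : Fin (m + 1) → Fin 2 := fun j => if j.1 < m then 0 else 1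
  let K : SimpleGraph (Fin 2) := ⊤
  have hl : ∀ i : Fin 2, (e (.inl i)).1 = i.1 := fun i => rfl
  have hr : ∀ j : Fin (m + 1), (e (.inr j)).1 = 2 + j.1 := fun j => rfl
  have hHH : ∀ i j, (doubleStar m 1).Adj (e (.inl i)) (e (.inl j)) ↔ K.Adj i j := by
    intro i j
    simp only [doubleStar, SimpleGraph.fromRel_adj, K, SimpleGraph.top_adj, ne_eq, Fin.ext_iff, hl]
    omega
  have hHL : ∀ i l, (doubleStar m 1).Adj (e (.inl i)) (e (.inr l)) ↔ f l = i := by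
    intro i l
    simp only [doubleStar, SimpleGraph.fromRel_adj, f, ne_eq, Fin.ext_iff, hl, hr]
    split_ifs <;> simp <;> omega
  have hLL : ∀ l l', ¬ (doubleStar m 1).Adj (e (.inr l)) (e (.inr l')) := by
    intro l l'
    simp only [doubleStar, SimpleGraph.fromRel_adj, ne_eq, Fin.ext_iff, hr]
    omega
  have c0 : (Finset.univ.filter (f · = 0)).card = m - 0 :=
    card_filter_fin_eq (by omega) _ fun j => by simp [f]
  have c1 : (Finset.univ.filter (f · = 1)).card = m + 1 - m :=
    card_filter_fin_eq le_rfl _ fun j => by simp [f]; omega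
  have hK : K.lapMatrix ℝ = !![1, -1; -1, 1] := by
    ext i j
    fin_cases i <;> fin_cases j <;>
      simp [K, SimpleGraph.lapMatrix, SimpleGraph.degMatrix]
  constructor
  · refine lapSpectrum_eq_of_eval_charpoly _ _ fun x hx => ?_
    have hx' : x - 1 ≠ 0 := sub_ne_zero.mpr hx
    obtain ⟨m, rfl⟩ := Nat.exists_eq_add_of_le' hm
    rw [det_sub_lapMatrix_of_pendant hHH hHL hLL hx, hK, Matrix.det_fin_two]
    have hprod : (Multiset.map (fun y => x - y) (Multiset.replicate (m + 1 - 1) 1 +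
        {0, a, b, c})).prod = (x - 1) ^ m * (x * ((x - a) * (x - b) * (x - c))) := by
      simp
      ring
    rw [hprod, ← h]
    simp [c0, c1]
    field_simp
    ring
  · have := card_edgeFinset_of_pendant hHH hHL hLL
    rw [avgDeg, this, hK]
    simp [Matrix.trace_fin_two]
    field_simp
    ring

theorem lapSpectrum_Ftree (n k : ℕ) {r s b c : ℝ} (hk : 2 ≤ k) (hn : 2 * k + 1 ≤ n)
    (hn' : 6 ≤ n)
    (hQ : ∀ x : ℝ, x ^ 2 - (k + 1) * x + 1 = (x - r) * (x - (k + 1 - r)))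
    (h : ∀ x : ℝ, x ^ 3 - (n - k + 3) * x ^ 2 + (1 + (n - 2 * k + 2) * (k + 1)) * x - n =
      (x - s) * (x - b) * (x - c)) :
    lapSpectrum (Ftree n k) = Multiset.replicate (n - 6) 1 + {0, r, k + 1 - r, s, b, c} ∧
      avgDeg (Ftree n k) = 2 - 2 / n := by
  obtain ⟨m, rfl⟩ : ∃ m, n = 3 + m := Nat.exists_eq_add_of_le (by omega)
  let e : Fin 3 ⊕ Fin m ≃ Fin (3 + m) := finSumFinEquiv
  let f : Fin m → Fin 3 := fun j => if j.1 < k - 1 then 1 else if j.1 < 2 * k - 2 then 2 else 0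
  let K : SimpleGraph (Fin 3) := starGraph 3
  have hl : ∀ i : Fin 3, (e (.inl i)).1 = i.1 := fun i => rfl
  have hr : ∀ j : Fin m, (e (.inr j)).1 = 3 + j.1 := fun j => rfl
  have hHH : ∀ i j, (Ftree (3 + m) k).Adj (e (.inl i)) (e (.inl j)) ↔ K.Adj i j := by
    intro i j
    simp only [Ftree, SimpleGraph.fromRel_adj, K, starGraph, ne_eq, Fin.ext_iff, hl]
    omega
  have hHL : ∀ i l, (Ftree (3 + m) k).Adj (e (.inl i)) (e (.inr l)) ↔ f l = i := by
    intro i l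
    simp only [Ftree, SimpleGraph.fromRel_adj, f, ne_eq, Fin.ext_iff, hl, hr]
    split_ifs <;> simp <;> omega
  have hLL : ∀ l l', ¬ (Ftree (3 + m) k).Adj (e (.inr l)) (e (.inr l')) := by
    intro l l'
    simp only [Ftree, SimpleGraph.fromRel_adj, ne_eq, Fin.ext_iff, hr]
    omega
  have c0 : (Finset.univ.filter (f · = 0)).card = m - (2 * k - 2) :=
    card_filter_fin_eq le_rfl _ fun j => by
      simp only [f]; split_ifs <;> simp <;> omega
  have c1 : (Finset.univ.filter (f · = 1)).card = k - 1 - 0 :=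
    card_filter_fin_eq (by omega) _ fun j => by
      simp only [f]; split_ifs <;> simp <;> omega
  have c2 : (Finset.univ.filter (f · = 2)).card = 2 * k - 2 - (k - 1) :=
    card_filter_fin_eq (by omega) _ fun j => by
      simp only [f]; split_ifs <;> simp <;> omega
  have hadj : ∀ i j, K.Adj i j ↔ i ≠ j ∧ (i = 0 ∨ j = 0) := fun i j => by
    simp only [K, starGraph, SimpleGraph.fromRel_adj, Fin.val_eq_zero_iff]
  have hdeg : ∀ i, (K.degree i : ℝ) = (if K.Adj i 0 then 1 else 0) +
      (if K.Adj i 1 then 1 else 0) + if K.Adj i 2 then 1 else 0 := fun i => by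
    rw [K.degree_eq_sum_if_adj, Fin.sum_univ_three]
  have hK : K.lapMatrix ℝ = !![2, -1, -1; -1, 1, 0; -1, 0, 1] := by
    ext i j
    simp only [SimpleGraph.lapMatrix, SimpleGraph.degMatrix, Matrix.sub_apply,
      Matrix.diagonal_apply, SimpleGraph.adjMatrix_apply, hdeg, hadj]
    fin_cases i <;> fin_cases j <;> norm_num [Fin.ext_iff]
  constructor
  · refine lapSpectrum_eq_of_eval_charpoly _ _ fun x hx => ?_
    have hx' : x - 1 ≠ 0 := sub_ne_zero.mpr hx
    have d0 : ((m - (2 * k - 2) : ℕ) : ℝ) = m - 2 * k + 2 := by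
      rw [Nat.cast_sub (by omega), Nat.cast_sub (by omega)]; push_cast; ring
    have d1 : ((k - 1 - 0 : ℕ) : ℝ) = k - 1 := by
      rw [Nat.sub_zero, Nat.cast_sub (by omega)]; push_cast; ring
    have d2 : ((2 * k - 2 - (k - 1) : ℕ) : ℝ) = k - 1 := by
      rw [Nat.cast_sub (by omega), Nat.cast_sub (by omega), Nat.cast_sub (by omega)]
      push_cast; ring
    rw [det_sub_lapMatrix_of_pendant hHH hHL hLL hx, hK, Matrix.det_fin_three]
    have hprod : (Multiset.map (fun a => x - a) (Multiset.replicate (3 + m - 6) 1 +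
        {0, r, k + 1 - r, s, b, c})).prod = (x - 1) ^ (m - 3) *
          (x * ((x - r) * (x - (k + 1 - r))) * ((x - s) * (x - b) * (x - c))) := by
      rw [show 3 + m - 6 = m - 3 by omega]
      simp
      ring
    rw [hprod, ← hQ, ← h]
    obtain ⟨m, rfl⟩ : ∃ l, m = 3 + l := Nat.exists_eq_add_of_le (by omega)
    simp only [Matrix.sub_apply, Matrix.diagonal_apply, c0, c1, c2, d0, d1, d2]
    simp
    field_simp
    ring
  · have := card_edgeFinset_of_pendant hHH hHL hLL
    rw [avgDeg, this, hK]
    simp [Matrix.trace_fin_three]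
    field_simp
    ring

theorem LE_doubleStar_lt {m : ℕ} (hm : 2 ≤ m) {β : ℝ} (hβ : β < 1)
    (h : β ^ 3 - (m + 5) * β ^ 2 + (3 * m + 7) * β - (m + 3) < 0) :
    LE (doubleStar m 1) < (m - 1) * (1 - 2 / (m + 3)) + m + 5 - 2 * β := by
  have hm' : (2 : ℝ) ≤ m := by exact_mod_cast hm
  obtain ⟨a, b, c, ha, hb, hc, hsum, hf⟩ := exists_cubic_factorization (p := m + 5)
    (q := 3 * m + 7) (r := m + 3) hβ one_le_two (by norm_num : (2 : ℝ) < 3)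
    (by linarith : (3 : ℝ) < m + 5) h (by linarith) (by linarith) (by linarith) (by nlinarith)
  obtain ⟨hs, hd⟩ := lapSpectrum_doubleStar m hf (by omega)
  rw [LE, hs, hd]
  have h0 : 0 < 2 / ((m : ℝ) + 3) := by positivity
  have h1 : 2 / ((m : ℝ) + 3) < 1 := by rw [div_lt_one (by linarith)]; linarith
  generalize 2 / ((m : ℝ) + 3) = t at *
  simp only [Multiset.map_add, Multiset.map_replicate, Multiset.sum_add, Multiset.sum_replicate,
    nsmul_eq_mul, Multiset.insert_eq_cons, Multiset.map_cons, Multiset.map_singleton,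
    Multiset.sum_cons, Multiset.sum_singleton]
  rw [abs_of_neg (by linarith : (1 : ℝ) - (2 - t) < 0), abs_of_neg (by linarith : 0 - (2 - t) < 0),
    abs_of_neg (by linarith [ha.2] : a - (2 - t) < 0),
    abs_of_pos (by linarith [hb.1] : 0 < b - (2 - t)),
    abs_of_pos (by linarith [hc.1] : 0 < c - (2 - t)), Nat.cast_sub (by omega)]
  push_cast
  linarith [ha.1]

theorem lt_LE_Ftree {n k : ℕ} (hk : 2 ≤ k) (hn : 3 * k ≤ n) {ρ σ : ℝ} (hρ₀ : 0 < ρ)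
    (hρ : ρ ^ 2 - (k + 1) * ρ + 1 < 0) (hσ₀ : 0 < σ) (hσ₁ : σ < 1)
    (hσ : 0 < σ ^ 3 - (n - k + 3) * σ ^ 2 + (1 + (n - 2 * k + 2) * (k + 1)) * σ - n) :
    (n - 6) * (1 - 2 / n) + n + 4 - 2 * ρ - 2 * σ < LE (Ftree n k) := by
  have hk' : (2 : ℝ) ≤ k := by exact_mod_cast hk
  have hn' : 3 * (k : ℝ) ≤ n := by exact_mod_cast hn
  obtain ⟨r, hr, hr'⟩ := intermediate_value_Ioo' hρ₀.le
    (f := fun x : ℝ => x ^ 2 - (k + 1) * x + 1) (by fun_prop) ⟨hρ, by norm_num⟩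
  simp only at hr'
  have h₁ : 0 ≤ (k - 1) * ((n : ℝ) + 2) ^ 2 := mul_nonneg (by linarith) (sq_nonneg _)
  have h₂ : 0 ≤ (n - 2 * k + 2) * ((k : ℝ) + 1) * (n + 2) :=
    mul_nonneg (mul_nonneg (by linarith) (by linarith)) (by linarith)
  obtain ⟨s, b, c, hs, hb, hc, hsum, hf⟩ := exists_cubic_factorization (p := n - k + 3)
    (q := 1 + (n - 2 * k + 2) * (k + 1)) (r := n) hσ₀ hσ₁.le
    (by linarith : (1 : ℝ) < k + 1) (by linarith : (k : ℝ) + 1 < n + 2) (by linarith) hσ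
    (by nlinarith) (by nlinarith)
    (by nlinarith)
  obtain ⟨hs', hd⟩ := lapSpectrum_Ftree n k (r := r) hk (by omega) (by omega)
    (fun x => by linear_combination hr') hf
  rw [LE, hs', hd]
  generalize 2 / (n : ℝ) = t at *
  simp only [Multiset.map_add, Multiset.map_replicate, Multiset.sum_add, Multiset.sum_replicate,
    nsmul_eq_mul, Multiset.insert_eq_cons, Multiset.map_cons, Multiset.map_singleton,
    Multiset.sum_cons, Multiset.sum_singleton]
  have h1 : (n - 6 : ℝ) * (1 - t) ≤ ((n - 6 : ℕ) : ℝ) * |1 - (2 - t)| := by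
    rw [Nat.cast_sub (by omega)]
    push_cast
    exact mul_le_mul_of_nonneg_left (by linarith [neg_abs_le (1 - (2 - t))]) (by linarith)
  linarith [neg_abs_le (0 - (2 - t)), neg_abs_le (r - (2 - t)), le_abs_self (k + 1 - r - (2 - t)),
    neg_abs_le (s - (2 - t)), le_abs_self (b - (2 - t)), le_abs_self (c - (2 - t)), hr.2, hs.2]

/-- Rational bounds separating the small eigenvalues of the two trees. -/
theorem exists_separating_bounds {n k : ℕ} (hn : 16 ≤ n) (hk : k = n / 3) :
    ∃ ρ σ β : ℝ, 0 < ρ ∧ ρ ^ 2 - (k + 1) * ρ + 1 < 0 ∧ 0 < σ ∧ σ < 1 ∧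
      0 < σ ^ 3 - (n - k + 3) * σ ^ 2 + (1 + (n - 2 * k + 2) * (k + 1)) * σ - n ∧ β < 1 ∧
      β ^ 3 - (n + 2) * β ^ 2 + (3 * n - 2) * β - n < 0 ∧ n * (ρ + σ - β) ≤ 2 := by
  rcases lt_or_ge n 27 with hlt | hge
  · subst hk
    interval_cases n
    · exact ⟨0.1716, 0.3633, 0.413, by norm_num⟩
    · exact ⟨0.1716, 0.34, 0.41, by norm_num⟩
    · exact ⟨0.146, 0.347, 0.4, by norm_num⟩
    · exact ⟨0.146, 0.325, 0.4, by norm_num⟩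
    · exact ⟨0.146, 0.31, 0.4, by norm_num⟩
    · exact ⟨0.1271, 0.31, 0.4, by norm_num⟩
    · exact ⟨0.1271, 0.3, 0.4, by norm_num⟩
    · exact ⟨0.1271, 0.3, 0.4, by norm_num⟩
    · exact ⟨0.1126, 0.28, 0.39, by norm_num⟩
    · exact ⟨0.1126, 0.28, 0.39, by norm_num⟩
    · exact ⟨0.1126, 0.28, 0.39, by norm_num⟩
  · have h9 : (9 : ℝ) ≤ k := by exact_mod_cast (by omega : 9 ≤ k)
    have h1 : 3 * (k : ℝ) ≤ n := by exact_mod_cast (by omega : 3 * k ≤ n)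
    have h2 : (n : ℝ) ≤ 3 * k + 2 := by exact_mod_cast (by omega : n ≤ 3 * k + 2)
    exact ⟨0.102, 0.27, 0.38, by norm_num, by linarith, by norm_num, by norm_num, by nlinarith,
      by norm_num, by linarith, by linarith⟩

/-- For `n ≥ 16` and `k = ⌊n/3⌋`, the diameter-4 tree `F(n,k)` has strictly
larger Laplacian energy than the diameter-3 double star `T(n-3, 1)`. -/
theorem LE_Ftree_gt_LE_doubleStar (n k : ℕ) (hn : 16 ≤ n) (hk : k = n / 3) :
    LE (Ftree n k) > LE (doubleStar (n - 3) 1) := by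
  obtain ⟨ρ, σ, β, hρ₀, hρ, hσ₀, hσ₁, hσ, hβ₁, hβ, hsep⟩ := exists_separating_bounds hn hk
  have hF := lt_LE_Ftree (by omega) (by omega) hρ₀ hρ hσ₀ hσ₁ hσ
  obtain ⟨m, rfl⟩ : ∃ m, n = m + 3 := Nat.exists_eq_add_of_le' (by omega)
  rw [Nat.add_sub_cancel]
  push_cast at *
  have hT := LE_doubleStar_lt (m := m) (by omega) hβ₁ (by linarith)
  have hdiv : ρ + σ - β ≤ 2 / ((m : ℝ) + 3) := by
    rw [le_div_iff₀ (by positivity)]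
    linarith
  linarith

end LapPaper
end

section
/- Let G be a connected graph with n ≥ 6 vertices, e(G) edges, and diameter d ≥ 4. Then S_k(G) < 2·e(G) − n + 2k − 2k/n for every integer k with 1 ≤ k ≤ n. -/
open Polynomial

namespace LapPaper

/-- The contribution of an edge to the Laplacian quadratic form. -/
def edgeSq {V : Type} (x : V → ℝ) : Sym2 V → ℝ :=
  Sym2.lift ⟨fun a b => (x a - x b) ^ 2, fun a b => by ring⟩

@[simp]
lemma edgeSq_mk {V : Type} (x : V → ℝ) (a b : V) : edgeSq x s(a, b) = (x a - x b) ^ 2 := rfl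

/-- `q` sums to at most `τ` over any subset of any orthonormal basis (the rows of `B`). -/
def TraceLE {V : Type} [Fintype V] [DecidableEq V] (q : (V → ℝ) → ℝ) (τ : ℝ) : Prop :=
  ∀ B : Matrix V V ℝ, B * B.transpose = 1 → ∀ s : Finset V, ∑ i ∈ s, q (B i) ≤ τ

section TraceLE

variable {V : Type} [Fintype V] [DecidableEq V]

lemma TraceLE.add {q r : (V → ℝ) → ℝ} {τ ρ : ℝ} (hq : TraceLE q τ) (hr : TraceLE r ρ) :
    TraceLE (fun x => q x + r x) (τ + ρ) := by
  intro B hB s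
  rw [Finset.sum_add_distrib]
  exact add_le_add (hq B hB s) (hr B hB s)

lemma TraceLE.sum {ι : Type*} (I : Finset ι) {q : ι → (V → ℝ) → ℝ} {τ : ι → ℝ}
    (h : ∀ i ∈ I, TraceLE (q i) (τ i)) : TraceLE (fun x => ∑ i ∈ I, q i x) (∑ i ∈ I, τ i) := by
  intro B hB s
  rw [Finset.sum_comm]
  exact Finset.sum_le_sum fun i hi => h i hi B hB s

lemma TraceLE.const_mul {q : (V → ℝ) → ℝ} {τ c : ℝ} (hc : 0 ≤ c) (hq : TraceLE q τ) :
    TraceLE (fun x => c * q x) (c * τ) := by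
  intro B hB s
  rw [← Finset.mul_sum]
  exact mul_le_mul_of_nonneg_left (hq B hB s) hc

lemma TraceLE.mono {q r : (V → ℝ) → ℝ} {τ ρ : ℝ} (hq : TraceLE q τ) (h : ∀ x, r x ≤ q x)
    (hτ : τ ≤ ρ) : TraceLE r ρ := by
  intro B hB s
  exact ((Finset.sum_le_sum fun i _ => h (B i)).trans (hq B hB s)).trans hτ

lemma traceLE_sq (g : V → ℝ) : TraceLE (fun x => (x ⬝ᵥ g) ^ 2) (g ⬝ᵥ g) := by
  intro B hB s
  have hB' : B.transpose * B = 1 := mul_eq_one_comm.mp hB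
  calc ∑ i ∈ s, (B i ⬝ᵥ g) ^ 2 ≤ ∑ i, (B i ⬝ᵥ g) ^ 2 :=
        Finset.sum_le_sum_of_subset_of_nonneg (Finset.subset_univ s) fun i _ _ => sq_nonneg _
    _ = (B.mulVec g) ⬝ᵥ (B.mulVec g) := by
        simp [dotProduct, Matrix.mulVec, sq]
    _ = g ⬝ᵥ g := by
        rw [Matrix.dotProduct_mulVec, ← Matrix.mulVec_transpose, Matrix.mulVec_mulVec, hB',
          Matrix.one_mulVec]

lemma traceLE_edgeSq (e : Sym2 V) : TraceLE (fun x => edgeSq x e) 2 := by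
  induction e with | _ a b => ?_
  rcases eq_or_ne a b with rfl | hab
  · intro B hB s
    simp
  · refine (traceLE_sq (Pi.single a 1 - Pi.single b 1)).mono (fun x => ?_) ?_
    · simp [dotProduct_sub]
    · simp [dotProduct_sub, hab, hab.symm]
      norm_num

end TraceLE

lemma sum_take_le_sum_finset {ι : Type} [Fintype ι] [DecidableEq ι] (f : ι → ℝ) (l : List ℝ)
    (hl : (l : Multiset ℝ) = Finset.univ.val.map f) (k : ℕ) (hk : k ≤ Fintype.card ι) :
    ∃ s : Finset ι, s.card = k ∧ (l.take k).sum = ∑ i ∈ s, f i := by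
  have h1 : ((l.take k : List ℝ) : Multiset ℝ) ≤ Finset.univ.val.map f := by
    rw [← hl]
    exact (List.take_sublist k l).subperm
  obtain ⟨r, hr⟩ := Multiset.le_iff_exists_add.mp h1
  have h2 : Multiset.Rel (fun a b => a = f b) ((l.take k : Multiset ℝ) + r) Finset.univ.val := by
    rw [← hr, Multiset.rel_map_left]
    exact Multiset.rel_refl_of_refl_on fun _ _ => rfl
  obtain ⟨u, u', hu, -, huu⟩ := Multiset.rel_add_left.mp h2
  have hmap : (l.take k : Multiset ℝ) = u.map f := by
    rw [← Multiset.rel_eq, Multiset.rel_map_right]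
    exact hu
  have hnd : u.Nodup :=
    Multiset.nodup_of_le (huu ▸ Multiset.le_add_right u u') (Finset.univ : Finset ι).nodup
  refine ⟨⟨u, hnd⟩, ?_, ?_⟩
  · have hc := congrArg Multiset.card hmap
    have hlen := congrArg Multiset.card hl
    simp only [Multiset.coe_card, List.length_take, Multiset.card_map, Finset.card_val,
      Finset.card_univ] at hc hlen
    rw [Finset.card_mk, ← hc, hlen, min_eq_left hk]
  · rw [← Multiset.sum_coe, hmap]
    rfl

lemma lapMatrix_quadraticForm {V : Type} [Fintype V] [DecidableEq V] (G : SimpleGraph V)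
    [DecidableRel G.Adj] (x : V → ℝ) :
    x ⬝ᵥ (G.lapMatrix ℝ).mulVec x = ∑ e ∈ G.edgeFinset, edgeSq x e := by
  have h1 : x ⬝ᵥ (G.lapMatrix ℝ).mulVec x =
      (∑ i, ∑ j, if G.Adj i j then (x i - x j) ^ 2 else 0) / 2 := by
    rw [← G.lapMatrix_toLinearMap₂' ℝ x, Matrix.toLinearMap₂'_apply']
  have h2 : ∑ d : G.Dart, edgeSq x d.edge = 2 * ∑ e ∈ G.edgeFinset, edgeSq x e := by
    rw [← Finset.sum_fiberwise_of_maps_to (t := G.edgeFinset) (g := fun d : G.Dart => d.edge)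
      (fun d _ => SimpleGraph.mem_edgeFinset.mpr d.edge_mem), Finset.mul_sum]
    refine Finset.sum_congr rfl fun e he => ?_
    rw [Finset.sum_congr rfl (g := fun _ => edgeSq x e)
      (fun d hd => by rw [(Finset.mem_filter.mp hd).2]), Finset.sum_const,
      G.dart_edge_fiber_card e (SimpleGraph.mem_edgeFinset.mp he)]
    simp
  have h3 : ∑ d : G.Dart, edgeSq x d.edge =
      ∑ i, ∑ j, if G.Adj i j then (x i - x j) ^ 2 else 0 := by
    rw [← Finset.sum_product', ← Finset.sum_filter]
    refine Finset.sum_bij (fun d _ => d.toProd) (fun d _ => by simp [d.adj])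
      (fun d _ d' _ h => SimpleGraph.Dart.ext _ _ h)
      (fun p hp => ⟨⟨p, (Finset.mem_filter.mp hp).2⟩, Finset.mem_univ _, rfl⟩)
      (fun d _ => rfl)
  rw [h1, ← h3, h2]
  ring

lemma Sk_le_of_traceLE {V : Type} [Fintype V] [DecidableEq V] (G : SimpleGraph V)
    [DecidableRel G.Adj] {k : ℕ} (hk : k ≤ Fintype.card V) {c τ : ℝ} {q : (V → ℝ) → ℝ}
    (hq : TraceLE q τ)
    (h : ∀ x : V → ℝ, ∑ e ∈ G.edgeFinset, edgeSq x e ≤ c * ∑ v, x v ^ 2 + q x) :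
    Sk G k ≤ c * k + τ := by
  have hA : (G.lapMatrix ℝ).IsHermitian := G.isHermitian_lapMatrix ℝ
  obtain ⟨s, hs, hsum⟩ := sum_take_le_sum_finset hA.eigenvalues
    (((lapSpectrum G).sort (· ≤ ·)).reverse) (by
      rw [Multiset.coe_reverse, Multiset.sort_eq, lapSpectrum, hA.roots_charpoly_eq_eigenvalues]
      rfl) k hk
  rw [Sk, hsum]
  let B : Matrix V V ℝ := Matrix.of fun i => (hA.eigenvectorBasis i : V → ℝ)
  have hdot : ∀ i j, B i ⬝ᵥ B j = if i = j then 1 else 0 := by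
    intro i j
    have := orthonormal_iff_ite.mp hA.eigenvectorBasis.orthonormal i j
    rw [← this, EuclideanSpace.inner_eq_star_dotProduct]
    rw [star_trivial, dotProduct_comm]
    rfl
  have hB : B * B.transpose = 1 := by
    ext i j
    rw [Matrix.mul_apply', Matrix.one_apply]
    exact hdot i j
  have hone : ∀ i, ∑ v, B i v ^ 2 = 1 := by
    intro i
    have := hdot i i
    simpa [dotProduct, sq] using this
  have heig : ∀ i, hA.eigenvalues i = ∑ e ∈ G.edgeFinset, edgeSq (B i) e := by
    intro i
    rw [← lapMatrix_quadraticForm]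
    have := hA.mulVec_eigenvectorBasis i
    change _ = B i ⬝ᵥ (G.lapMatrix ℝ).mulVec (hA.eigenvectorBasis i)
    rw [this]
    change _ = B i ⬝ᵥ (hA.eigenvalues i • B i)
    rw [dotProduct_smul, hdot]
    simp
  calc ∑ i ∈ s, hA.eigenvalues i ≤ ∑ i ∈ s, (c + q (B i)) := by
        refine Finset.sum_le_sum fun i _ => ?_
        rw [heig]
        simpa [hone] using h (B i)
    _ = c * k + ∑ i ∈ s, q (B i) := by
        rw [Finset.sum_add_distrib, Finset.sum_const, hs, nsmul_eq_mul, mul_comm]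
    _ ≤ _ := by gcongr; exact hq B hB s

/-- A spanning forest of stars with at least one edge each: `z v` is the centre of the star
containing `v`. -/
structure StarForest {V : Type} [Fintype V] [DecidableEq V] (G : SimpleGraph V) where
  z : V → V
  idem : ∀ v, z (z v) = z v
  adj : ∀ v, z v ≠ v → G.Adj v (z v)
  two_le : ∀ i, z i = i → 2 ≤ (Finset.univ.filter fun v => z v = i).card

namespace StarForest

variable {V : Type} [Fintype V] [DecidableEq V] {G : SimpleGraph V}
  (F : StarForest G)

/-- The centres of the stars. -/
def centres : Finset V := Finset.univ.filter fun i => F.z i = i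

/-- The vertex set of the star with centre `i`. -/
def star (i : V) : Finset V := Finset.univ.filter fun v => F.z v = i

/-- The number of vertices of the star with centre `i`. -/
noncomputable def size (i : V) : ℝ := (F.star i).card

/-- The average of `x` over the star with centre `i`. -/
noncomputable def mean (x : V → ℝ) (i : V) : ℝ := (∑ v ∈ F.star i, x v) / F.size i

/-- The squared deviation of `x` from its average over the leaves of the star with centre `i`. -/
noncomputable def leafDev (x : V → ℝ) (i : V) : ℝ :=
  ∑ v ∈ (F.star i).erase i, x v ^ 2 - (∑ v ∈ (F.star i).erase i, x v) ^ 2 / (F.size i - 1)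

/-- The edges of `G` outside the star forest. -/
def rest [DecidableRel G.Adj] : Finset (Sym2 V) :=
  G.edgeFinset \ (F.centresᶜ.image fun v => s(v, F.z v))

@[simp] lemma mem_centres {i : V} : i ∈ F.centres ↔ F.z i = i := by simp [centres]

@[simp] lemma mem_star {i v : V} : v ∈ F.star i ↔ F.z v = i := by simp [star]

lemma z_mem_centres (v : V) : F.z v ∈ F.centres := by simp [F.idem]

lemma two_le_size {i : V} (hi : i ∈ F.centres) : 2 ≤ F.size i := by
  have := F.two_le i (by simpa using hi)
  unfold size star
  exact_mod_cast this

lemma sum_star (f : V → ℝ) : ∑ i ∈ F.centres, ∑ v ∈ F.star i, f v = ∑ v, f v :=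
  Finset.sum_fiberwise_of_maps_to (fun v _ => F.z_mem_centres v) f

lemma sum_size : ∑ i ∈ F.centres, F.size i = Fintype.card V := by
  have := F.sum_star fun _ => 1
  simpa [size] using this

lemma two_mul_card_centres_le : 2 * (F.centres.card : ℝ) ≤ Fintype.card V := by
  rw [← F.sum_size, mul_comm, ← nsmul_eq_mul]
  exact Finset.card_nsmul_le_sum _ _ _ fun i hi => F.two_le_size hi

lemma starEdge_injOn : Set.InjOn (fun v => s(v, F.z v)) (F.centresᶜ : Finset V) := by
  intro v hv w hw h
  simp only [Finset.coe_compl, Set.mem_compl_iff, Finset.mem_coe, mem_centres] at hv hw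
  rcases Sym2.eq_iff.mp h with ⟨h1, -⟩ | ⟨h1, h2⟩
  · exact h1
  · exact absurd (h1 ▸ F.idem w) hv

lemma starEdges_subset [DecidableRel G.Adj] :
    (F.centresᶜ.image fun v => s(v, F.z v)) ⊆ G.edgeFinset := by
  intro e he
  obtain ⟨v, hv, rfl⟩ := Finset.mem_image.mp he
  simp only [Finset.mem_compl, mem_centres] at hv
  simpa using F.adj v hv

lemma mem_rest [DecidableRel G.Adj] {a b : V} (hab : G.Adj a b) (h : F.z a ≠ F.z b) :
    s(a, b) ∈ F.rest := by
  simp only [rest, Finset.mem_sdiff, SimpleGraph.mem_edgeFinset, SimpleGraph.mem_edgeSet, hab,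
    Finset.mem_image, not_exists, not_and, true_and]
  intro v _ hv
  rcases Sym2.eq_iff.mp hv with ⟨rfl, rfl⟩ | ⟨rfl, rfl⟩
  · exact h (F.idem v).symm
  · exact h (F.idem v)

lemma card_rest [DecidableRel G.Adj] :
    (F.rest.card : ℝ) = G.edgeFinset.card - (Fintype.card V - F.centres.card) := by
  have h1 := Finset.card_sdiff_add_card_eq_card F.starEdges_subset
  rw [Finset.card_image_of_injOn F.starEdge_injOn] at h1
  have h2 := Finset.card_add_card_compl F.centres
  change F.rest.card + _ = _ at h1
  have h1' : (F.rest.card : ℝ) + (F.centresᶜ.card : ℝ) = G.edgeFinset.card := by exact_mod_cast h1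
  have h2' : (F.centres.card : ℝ) + (F.centresᶜ.card : ℝ) = Fintype.card V := by exact_mod_cast h2
  linarith

lemma sum_edgeSq [DecidableRel G.Adj] (x : V → ℝ) : ∑ e ∈ G.edgeFinset, edgeSq x e =
    ∑ i ∈ F.centres, ∑ v ∈ (F.star i).erase i, (x v - x i) ^ 2 + ∑ e ∈ F.rest, edgeSq x e := by
  rw [rest, ← Finset.sum_sdiff F.starEdges_subset, add_comm,
    Finset.sum_image F.starEdge_injOn]
  congr 1
  have h1 : ∑ v ∈ F.centresᶜ, edgeSq x s(v, F.z v) = ∑ v, (x v - x (F.z v)) ^ 2 := by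
    refine Finset.sum_subset (Finset.subset_univ _) fun v _ hv => ?_
    simp only [Finset.mem_compl, mem_centres, not_not] at hv
    simp [hv]
  rw [h1, ← F.sum_star]
  refine Finset.sum_congr rfl fun i hi => ?_
  rw [← Finset.sum_erase_add (F.star i) _ (by simpa using hi : i ∈ F.star i)]
  have hi' : F.z i = i := by simpa using hi
  rw [hi', sub_self, zero_pow two_ne_zero, add_zero]
  refine Finset.sum_congr rfl fun v hv => ?_
  have : F.z v = i := by simpa using Finset.mem_of_mem_erase hv
  rw [this]

lemma card_leaves {i : V} (hi : i ∈ F.centres) :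
    (((F.star i).erase i).card : ℝ) = F.size i - 1 := by
  have hi' : i ∈ F.star i := by simpa using hi
  rw [Finset.card_erase_of_mem hi', Nat.cast_pred (Finset.card_pos.mpr ⟨i, hi'⟩), size]

lemma leafDev_nonneg (x : V → ℝ) {i : V} (hi : i ∈ F.centres) : 0 ≤ F.leafDev x i := by
  have hN := F.two_le_size hi
  rw [leafDev, sub_nonneg, div_le_iff₀ (by linarith), ← F.card_leaves hi, mul_comm]
  exact sq_sum_le_card_mul_sum_sq

lemma sum_star_sq (x : V → ℝ) (c : ℝ) {i : V} (hi : i ∈ F.centres) :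
    ∑ v ∈ (F.star i).erase i, (x v - x i) ^ 2 + c * (F.size i * F.mean x i ^ 2)
      + (c - 1) * F.leafDev x i =
    c * ∑ v ∈ F.star i, x v ^ 2
      + (F.size i - c) * (F.size i / (F.size i - 1) * (x i - F.mean x i) ^ 2) := by
  have hi' : i ∈ F.star i := by simpa using hi
  have hN := F.two_le_size hi
  have hcard := F.card_leaves hi
  have h1 : ∑ v ∈ (F.star i).erase i, (x v - x i) ^ 2 =
      ∑ v ∈ (F.star i).erase i, x v ^ 2 - 2 * x i * ∑ v ∈ (F.star i).erase i, x v
        + (F.size i - 1) * x i ^ 2 := by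
    rw [← hcard, ← nsmul_eq_mul, ← Finset.sum_const, Finset.mul_sum, ← Finset.sum_sub_distrib,
      ← Finset.sum_add_distrib]
    exact Finset.sum_congr rfl fun v _ => by ring
  rw [h1, leafDev, mean, ← Finset.sum_erase_add _ _ hi', ← Finset.sum_erase_add _ _ hi']
  have h2 : F.size i ≠ 0 := by linarith
  have h3 : F.size i - 1 ≠ 0 := by linarith
  field_simp
  ring

lemma mean_eq_dotProduct (x : V → ℝ) (i : V) :
    F.mean x i = x ⬝ᵥ fun v => if F.z v = i then (F.size i)⁻¹ else 0 := by
  simp [mean, dotProduct, star, Finset.sum_filter, div_eq_mul_inv, Finset.sum_mul]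

lemma traceLE_centre {i : V} (hi : i ∈ F.centres) :
    TraceLE (fun x => F.size i / (F.size i - 1) * (x i - F.mean x i) ^ 2) 1 := by
  have hN := F.two_le_size hi
  have hi' : F.z i = i := by simpa using hi
  have h := (traceLE_sq (Pi.single i 1 -
    fun v => if F.z v = i then (F.size i)⁻¹ else 0)).const_mul
    (div_nonneg (by linarith) (by linarith) : 0 ≤ F.size i / (F.size i - 1))
  refine h.mono (fun x => ?_) ?_
  · rw [dotProduct_sub, ← F.mean_eq_dotProduct]
    simp
  · have h1 : (fun v => if F.z v = i then (F.size i)⁻¹ else 0) ⬝ᵥ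
        (fun v => if F.z v = i then (F.size i)⁻¹ else 0) = (F.size i)⁻¹ := by
      rw [← F.mean_eq_dotProduct, mean, Finset.sum_congr rfl
        (g := fun _ => (F.size i)⁻¹) (fun v hv => if_pos (by simpa using hv)), Finset.sum_const,
        nsmul_eq_mul, ← size, mul_inv_cancel₀ (by linarith), one_div]
    have h2 : F.size i ≠ 0 := by linarith
    have h3 : F.size i - 1 ≠ 0 := by linarith
    rw [sub_dotProduct, dotProduct_sub, dotProduct_sub, h1]
    simp only [single_dotProduct, dotProduct_single, Pi.single_eq_same, hi', if_true]
    apply le_of_eq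
    field_simp
    ring

lemma Sk_le [DecidableRel G.Adj] {k : ℕ} (hk : k ≤ Fintype.card V) {c τ : ℝ}
    (hc : ∀ i ∈ F.centres, c ≤ F.size i) (T : Finset (Sym2 V)) (hT : T ⊆ F.rest)
    {q : (V → ℝ) → ℝ} (hq : TraceLE q τ)
    (h : ∀ x : V → ℝ, ∑ e ∈ T, edgeSq x e ≤ c * ∑ i ∈ F.centres, F.size i * F.mean x i ^ 2
      + (c - 1) * ∑ i ∈ F.centres, F.leafDev x i + q x) :
    Sk G k ≤ 2 * G.edgeFinset.card - Fintype.card V + (2 - c) * F.centres.card + c * k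
      - (2 * T.card - τ) := by
  have h1 := TraceLE.sum F.centres fun i hi =>
    (F.traceLE_centre hi).const_mul (sub_nonneg.mpr (hc i hi))
  have h2 := TraceLE.sum (F.rest \ T) fun e _ => traceLE_edgeSq (V := V) e
  refine (Sk_le_of_traceLE G (c := c) hk ((h1.add h2).add hq) fun x => ?_).trans ?_
  · have h3 := Finset.sum_congr rfl fun i hi => F.sum_star_sq x c (i := i) hi
    rw [Finset.sum_add_distrib, Finset.sum_add_distrib, Finset.sum_add_distrib, ← Finset.mul_sum,
      ← Finset.mul_sum, ← Finset.mul_sum, F.sum_star] at h3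
    rw [F.sum_edgeSq, ← Finset.sum_sdiff hT]
    linarith [h x]
  · simp only [mul_one, Finset.sum_sub_distrib, F.sum_size, Finset.sum_const, nsmul_eq_mul]
    have h4 := Finset.card_sdiff_add_card_eq_card hT
    have h4' : ((F.rest \ T).card : ℝ) + T.card = F.rest.card := by exact_mod_cast h4
    have h5 := F.card_rest
    apply le_of_eq
    linear_combination 2 * h4' + 2 * h5

/-- The vector representing the functional `F.mean · i`. -/
noncomputable def meanVec (i : V) : V → ℝ := fun v => if F.z v = i then (F.size i)⁻¹ else 0

lemma dotProduct_meanVec (x : V → ℝ) (i : V) : x ⬝ᵥ F.meanVec i = F.mean x i :=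
  (F.mean_eq_dotProduct x i).symm

lemma meanVec_dotProduct_meanVec {i : V} (hi : i ∈ F.centres) (j : V) :
    F.meanVec i ⬝ᵥ F.meanVec j = if i = j then (F.size i)⁻¹ else 0 := by
  have hN := F.two_le_size hi
  rw [dotProduct_meanVec, mean]
  unfold meanVec
  split_ifs with h
  · subst h
    rw [Finset.sum_congr rfl (g := fun _ => (F.size i)⁻¹) (fun v hv => if_pos (by simpa using hv)),
      Finset.sum_const, nsmul_eq_mul, ← size, mul_inv_cancel₀ (by linarith), one_div]
  · rw [Finset.sum_eq_zero, zero_div]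
    intro v hv
    have : F.z v = j := by simpa using hv
    exact if_neg (this ▸ Ne.symm h)

/-- The difference of the indicators of the ends of an edge. -/
def edgeVec (a b : V) : V → ℝ := Pi.single a 1 - Pi.single b 1

omit [Fintype V] in
lemma edgeVec_apply (a b v : V) :
    edgeVec a b v = (if v = a then 1 else 0) - if v = b then 1 else 0 := by
  simp [edgeVec, Pi.single_apply]

lemma dotProduct_edgeVec (x : V → ℝ) (a b : V) : x ⬝ᵥ edgeVec a b = x a - x b := by
  simp [edgeVec, dotProduct_sub]

lemma traceLE_edge_of_subset {c : ℝ} (hc : 1 ≤ c) {a b : V} (hab : F.z a ≠ F.z b) {I : Finset V}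
    (hI : I.Nonempty) (hIab : ∀ i ∈ I, i = F.z a ∨ i = F.z b) :
    ∃ (q : (V → ℝ) → ℝ) (τ : ℝ), TraceLE q τ ∧
      τ < 2 - c / (c + 2) * ∑ i ∈ I, (F.size i)⁻¹ ∧
      ∀ x : V → ℝ, edgeSq x s(a, b) ≤ c * ∑ i ∈ I, F.size i * F.mean x i ^ 2 + q x := by
  have hIC : ∀ i ∈ I, i ∈ F.centres := fun i hi => by
    rcases hIab i hi with rfl | rfl <;> exact F.z_mem_centres _
  have hN : ∀ i ∈ I, 2 ≤ F.size i := fun i hi => F.two_le_size (hIC i hi)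
  set s : ℝ := ∑ i ∈ I, (F.size i)⁻¹ with hs
  have hs0 : 0 < s := Finset.sum_pos (fun i hi => inv_pos.mpr (by linarith [hN i hi])) hI
  have hs1 : s ≤ 1 := by
    have h1 : I.card ≤ 2 := by
      refine (Finset.card_le_card (t := {F.z a, F.z b}) fun i hi => ?_).trans Finset.card_le_two
      simpa using hIab i hi
    have h2 : s ≤ I.card • (1 / 2 : ℝ) := Finset.sum_le_card_nsmul _ _ _ fun i hi => by
      rw [inv_le_comm₀ (by linarith [hN i hi]) (by norm_num)]
      linarith [hN i hi]
    have h3 : (I.card : ℝ) ≤ 2 := by exact_mod_cast h1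
    rw [nsmul_eq_mul] at h2
    linarith
  set κ : ℝ := c / (c + 2) with hκ
  have hκ0 : 0 < κ := by positivity
  have hκc : κ * (c + 2) = c := by rw [hκ]; field_simp
  have hκ2 : κ ^ 2 / c ≤ 1 / 8 := by
    rw [div_le_div_iff₀ (by positivity) (by norm_num)]
    have : κ ^ 2 = κ * (κ * 1) := by ring
    rw [hκ, div_pow, div_mul_eq_mul_div, div_le_iff₀ (by positivity)]
    nlinarith [sq_nonneg (c - 2)]
  set Δ : ℝ := 1 - κ ^ 2 / c * s with hΔ
  have hΔ0 : 0 < Δ := by nlinarith [div_pos (pow_pos hκ0 2) (by linarith : 0 < c)]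
  let σ : V → ℝ := fun i => (if F.z a = i then 1 else 0) - if F.z b = i then 1 else 0
  have hσ : ∀ i ∈ I, σ i ^ 2 = 1 := fun i hi => by
    rcases hIab i hi with rfl | rfl <;> simp [σ, hab, hab.symm]
  let w : V → ℝ := ∑ i ∈ I, σ i • F.meanVec i
  have hxw : ∀ x : V → ℝ, x ⬝ᵥ w = ∑ i ∈ I, σ i * F.mean x i := fun x => by
    simp only [w, dotProduct_sum, dotProduct_smul, dotProduct_meanVec, smul_eq_mul]
  have hbw : edgeVec a b ⬝ᵥ w = s := by
    rw [dotProduct_comm, dotProduct_edgeVec]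
    simp only [w, Finset.sum_apply, Pi.smul_apply, ← Finset.sum_sub_distrib, smul_eq_mul, hs]
    refine Finset.sum_congr rfl fun i hi => ?_
    rw [← mul_sub, ← one_mul (F.size i)⁻¹, ← hσ i hi, sq, mul_assoc]
    congr 1
    simp only [meanVec, σ]
    split_ifs <;> ring
  have hww : w ⬝ᵥ w = s := by
    rw [hxw, hs]
    refine Finset.sum_congr rfl fun i hi => ?_
    have : F.mean w i = σ i * (F.size i)⁻¹ := by
      rw [← dotProduct_meanVec, sum_dotProduct, Finset.sum_eq_single i]
      · rw [smul_dotProduct, F.meanVec_dotProduct_meanVec (hIC i hi), if_pos rfl, smul_eq_mul]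
      · intro j hj hji
        rw [smul_dotProduct, F.meanVec_dotProduct_meanVec (hIC j hj), if_neg hji, smul_zero]
      · exact fun h => absurd hi h
    rw [this, ← mul_assoc, ← sq, hσ i hi, one_mul]
  refine ⟨_, _, (traceLE_sq (edgeVec a b - κ • w)).const_mul (inv_nonneg.mpr hΔ0.le), ?_, ?_⟩
  · have hbb : edgeVec a b ⬝ᵥ edgeVec a b = 2 := by
      have : a ≠ b := fun h => hab (h ▸ rfl)
      rw [dotProduct_edgeVec, edgeVec_apply, edgeVec_apply]
      simp [this, this.symm]
      norm_num
    simp only [sub_dotProduct, dotProduct_sub, smul_dotProduct, dotProduct_smul, smul_eq_mul, hbb,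
      hww, hbw, dotProduct_comm w (edgeVec a b)]
    rw [inv_mul_lt_iff₀ hΔ0]
    have h1 : Δ * c = c - κ ^ 2 * s := by rw [hΔ]; field_simp
    refine lt_of_mul_lt_mul_right (a := c) ?_ (by linarith)
    rw [mul_right_comm, h1]
    have h2 : 0 < κ ^ 3 * s ^ 2 := by positivity
    have h3 : κ * s * (κ * (c + 2)) = κ * s * c := by rw [hκc]
    linarith
  · intro x
    rw [edgeSq_mk, ← dotProduct_edgeVec, dotProduct_sub, dotProduct_smul, smul_eq_mul]
    set X := x ⬝ᵥ edgeVec a b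
    set y := x ⬝ᵥ w with hy
    have hP : y ^ 2 ≤ s * ∑ i ∈ I, F.size i * F.mean x i ^ 2 := by
      rw [hy, hxw, hs]
      refine Finset.sum_sq_le_sum_mul_sum_of_sq_le_mul I
        (fun i hi => inv_nonneg.mpr (by linarith [hN i hi]))
        (fun i hi => mul_nonneg (by linarith [hN i hi]) (sq_nonneg _)) fun i hi => le_of_eq ?_
      rw [mul_pow, hσ i hi, inv_mul_cancel_left₀ (by linarith [hN i hi]), one_mul]
    set P := ∑ i ∈ I, F.size i * F.mean x i ^ 2
    have h1 : X ^ 2 ≤ c * (y ^ 2 / s) + Δ⁻¹ * (X - κ * y) ^ 2 := by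
      have : c * (y ^ 2 / s) + Δ⁻¹ * (X - κ * y) ^ 2 - X ^ 2 =
          c / (s * Δ) * (y - κ / c * s * X) ^ 2 := by
        obtain ⟨D, hD⟩ : ∃ D, D = c - κ ^ 2 * s := ⟨_, rfl⟩
        have hc' : c ≠ 0 := by linarith
        have hΔe : Δ = D / c := by rw [hΔ, hD]; field_simp
        have hD' : D ≠ 0 := fun h => hΔ0.ne' (by rw [hΔe, h, zero_div])
        rw [hΔe]
        field_simp
        rw [hD]
        ring
      have h2 : 0 ≤ c / (s * Δ) * (y - κ / c * s * X) ^ 2 := by positivity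
      linarith
    have h2 : y ^ 2 / s ≤ P := by rwa [div_le_iff₀' hs0]
    nlinarith

lemma exists_adj_of_connected (hG : G.Connected) (ht : 2 ≤ F.centres.card) {i : V}
    (hi : i ∈ F.centres) : ∃ a b, G.Adj a b ∧ F.z a = i ∧ F.z b ≠ i := by
  obtain ⟨j, hj, hji⟩ := Finset.exists_mem_ne ht i
  obtain ⟨p⟩ := hG.preconnected i j
  obtain ⟨d, -, h1, h2⟩ := p.exists_boundary_dart {v | F.z v = i} (by simpa using hi)
    (by simpa [(F.mem_centres).mp hj] using hji)
  exact ⟨d.fst, d.snd, d.adj, h1, h2⟩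

lemma sq_card_centres_div_le :
    (F.centres.card : ℝ) ^ 2 / Fintype.card V ≤ ∑ i ∈ F.centres, (F.size i)⁻¹ := by
  have h := Finset.sq_sum_div_le_sum_sq_div F.centres (fun _ => (1 : ℝ)) (g := F.size)
    fun i hi => by linarith [F.two_le_size hi]
  simpa [F.sum_size] using h

lemma Sk_lt_of_connected [DecidableRel G.Adj] (hG : G.Connected) (ht : 2 ≤ F.centres.card)
    {k : ℕ} (hk : k ≤ Fintype.card V) {c : ℝ} (hc1 : 1 ≤ c)
    (hc : ∀ i ∈ F.centres, c ≤ F.size i) :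
    Sk G k < 2 * G.edgeFinset.card - Fintype.card V + (2 - c) * F.centres.card + c * k
      - c / (c + 2) * (F.centres.card ^ 2 / Fintype.card V) := by
  choose! α β hadj hα hβ using fun (i : V) (hi : i ∈ F.centres) =>
    F.exists_adj_of_connected hG ht hi
  let e : V → Sym2 V := fun i => s(α i, β i)
  let T := F.centres.image e
  have hT : T ⊆ F.rest := fun x hx => by
    obtain ⟨i, hi, rfl⟩ := Finset.mem_image.mp hx
    exact F.mem_rest (hadj i hi) (by rw [hα i hi]; exact (hβ i hi).symm)
  have key : ∀ x ∈ T, ∃ (q : (V → ℝ) → ℝ) (τ : ℝ), TraceLE q τ ∧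
      τ < 2 - c / (c + 2) * ∑ i ∈ F.centres.filter (fun i => e i = x), (F.size i)⁻¹ ∧
      ∀ y : V → ℝ, edgeSq y x ≤
        c * ∑ i ∈ F.centres.filter (fun i => e i = x), F.size i * F.mean y i ^ 2 + q y := by
    intro x hx
    obtain ⟨j, hj, rfl⟩ := Finset.mem_image.mp hx
    refine F.traceLE_edge_of_subset hc1 (by rw [hα j hj]; exact (hβ j hj).symm)
      ⟨j, Finset.mem_filter.mpr ⟨hj, rfl⟩⟩ fun i hi => ?_
    obtain ⟨hi, hij⟩ := Finset.mem_filter.mp hi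
    rcases Sym2.eq_iff.mp hij with ⟨h, -⟩ | ⟨h, -⟩
    · exact Or.inl (by rw [← h, hα i hi])
    · exact Or.inr (by rw [← h, hα i hi])
  choose! q τ hq hτ hqx using key
  have hTne : T.Nonempty := (Finset.card_pos.mp (by omega)).image e
  have hfib : ∀ f : V → ℝ, ∑ x ∈ T, ∑ i ∈ F.centres.filter (fun i => e i = x), f i =
      ∑ i ∈ F.centres, f i :=
    fun f => Finset.sum_fiberwise_of_maps_to (fun i hi => Finset.mem_image_of_mem e hi) f
  have hdev : ∀ x : V → ℝ, 0 ≤ ∑ i ∈ F.centres, F.leafDev x i := fun x =>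
    Finset.sum_nonneg fun i hi => F.leafDev_nonneg x hi
  have hτsum := Finset.sum_lt_sum_of_nonempty hTne hτ
  rw [Finset.sum_sub_distrib, ← Finset.mul_sum, hfib, Finset.sum_const, nsmul_eq_mul] at hτsum
  have h := F.Sk_le hk hc T hT (TraceLE.sum T hq) fun x => by
    have h1 := Finset.sum_le_sum fun y hy => hqx y hy x
    rw [Finset.sum_add_distrib, ← Finset.mul_sum, hfib] at h1
    nlinarith [hdev x]
  have h2 := mul_le_mul_of_nonneg_left F.sq_card_centres_div_le
    (by positivity : 0 ≤ c / (c + 2))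
  linarith

end StarForest

/-- `z` sends every vertex to the centre of its star, where single vertices count as stars. -/
def IsStarMap {V : Type} (G : SimpleGraph V) (z : V → V) : Prop :=
  (∀ v, z (z v) = z v) ∧ ∀ v, z v ≠ v → G.Adj v (z v)

/-- `i` is the centre of a star with at least one edge. -/
def IsBigCentre {V : Type} (z : V → V) (i : V) : Prop := z i = i ∧ ∃ w, w ≠ i ∧ z w = i

section IsStarMap

variable {V : Type} [Fintype V] [DecidableEq V] {G : SimpleGraph V}

/-- The vertices that form a star on their own. -/
def singles (z : V → V) : Finset V := Finset.univ.filter fun i => z i = i ∧ ∀ w, z w = i → w = i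

omit [Fintype V] in
lemma IsStarMap.exists_attach {z : V → V} (hz : IsStarMap G z) {w x : V} (hwx : G.Adj w x)
    (hw : z w = w) (hw' : ∀ v, z v = w → v = w)
    (hx : z x ≠ x ∨ ∃ v, v ≠ x ∧ z v = x) :
    ∃ z' : V → V, IsStarMap G z' ∧ z' w = x ∧
      (∀ v, z' v = v → (∀ u, z' u = v → u = v) → z v = v ∧ ∀ u, z u = v → u = v) ∧
      ∃ φ : V → V, Function.Injective φ ∧ ∀ i, IsBigCentre z i → IsBigCentre z' (φ i) := by
  have hne : w ≠ x := hwx.ne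
  obtain ⟨hidem, hadj⟩ := hz
  have hxw : z x ≠ w := fun h => hne (hw' x h).symm
  by_cases hzx : z x = x
  · obtain ⟨v, hv, hvx⟩ := hx.resolve_left (not_not.mpr hzx)
    obtain ⟨z', hz'⟩ : ∃ z' : V → V, ∀ u, z' u = if u = w then x else z u := ⟨_, fun _ => rfl⟩
    have hz : ∀ u, z u = if u = w then w else z' u := by grind
    have hzw : z' w = x := by grind
    have hzx' : z' x = x := by grind
    refine ⟨z', ⟨?_, ?_⟩, hzw, ?_, id, Function.injective_id, ?_⟩
    · grind
    · grind
    · grind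
    · simp only [IsBigCentre, id]
      grind
  · have hc := hadj x hzx
    have hzz := hidem x
    by_cases hy : ∃ y, y ≠ x ∧ y ≠ z x ∧ z y = z x
    · obtain ⟨z', hz'⟩ : ∃ z' : V → V, ∀ u, z' u = if u = w ∨ u = x then x else z u :=
        ⟨_, fun _ => rfl⟩
      have hz : ∀ u, z u = if u = w then w else if u = x then z x else z' u := by grind
      have hzw : z' w = x := by grind
      have hzx' : z' x = x := by grind
      refine ⟨z', ⟨?_, ?_⟩, hzw, ?_, id, Function.injective_id, ?_⟩
      · grind
      · grind
      · grind
      · simp only [IsBigCentre, id]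
        grind
    · push Not at hy
      obtain ⟨z', hz'⟩ : ∃ z' : V → V, ∀ u, z' u = if u = w ∨ u = x ∨ u = z x then x else z u :=
        ⟨_, fun _ => rfl⟩
      have hz : ∀ u, z u = if u = w then w else if u = x ∨ u = z x then z x else z' u := by grind
      have hzw : z' w = x := by grind
      have hzx' : z' x = x := by grind
      refine ⟨z', ⟨?_, ?_⟩, hzw, ?_, Equiv.swap x (z x), Equiv.injective _, ?_⟩
      · grind
      · have := G.adj_comm x (z x)
        grind
      · grind
      · simp only [IsBigCentre, Equiv.swap_apply_def]
        grind

lemma IsStarMap.exists_starForest (hG : G.Connected) {z : V → V} (hz : IsStarMap G z)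
    {I : Finset V} (hI : I.Nonempty) (hbig : ∀ i ∈ I, IsBigCentre z i) :
    ∃ F : StarForest G, I.card ≤ F.centres.card := by
  induction hm : (singles z).card using Nat.strong_induction_on generalizing z I with | _ m ih => ?_
  by_cases hs : (singles z).Nonempty
  · obtain ⟨w₀, hw₀⟩ := hs
    obtain ⟨i, hi⟩ := hI
    obtain ⟨p⟩ := hG.preconnected w₀ i
    obtain ⟨d, -, h1, h2⟩ := p.exists_boundary_dart (singles z) (by simpa using hw₀) (by
      have := hbig i hi
      simp only [singles, IsBigCentre] at *
      grind)
    simp only [singles, Finset.coe_filter, Finset.mem_univ, true_and, Set.mem_ofPred_eq] at h1 h2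
    obtain ⟨z', hz', hzw, hsing, φ, hφ, hbig'⟩ := hz.exists_attach d.adj h1.1 h1.2 (by grind)
    have hlt : (singles z').card < m := by
      rw [← hm]
      refine Finset.card_lt_card ((Finset.ssubset_iff_of_subset fun v hv => ?_).mpr
        ⟨d.fst, by simpa [singles] using h1, ?_⟩)
      · simp only [singles, Finset.mem_filter, Finset.mem_univ, true_and] at hv ⊢
        exact hsing v hv.1 hv.2
      · simp only [singles, Finset.mem_filter, Finset.mem_univ, true_and, hzw, not_and]
        exact fun h => absurd h d.adj.ne'
    obtain ⟨F, hF⟩ := ih _ hlt hz' (I := I.image φ) ((Finset.image_nonempty).mpr ⟨i, hi⟩) (by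
      intro j hj
      obtain ⟨i, hi, rfl⟩ := Finset.mem_image.mp hj
      exact hbig' i (hbig i hi)) rfl
    rw [Finset.card_image_of_injective _ hφ] at hF
    exact ⟨F, hF⟩
  · refine ⟨⟨z, hz.1, hz.2, fun i hi => ?_⟩, Finset.card_le_card fun i hi => ?_⟩
    · rw [Finset.not_nonempty_iff_eq_empty, singles, Finset.filter_eq_empty_iff] at hs
      have := hs (Finset.mem_univ i)
      push Not at this
      obtain ⟨w, hw, hwi⟩ := this hi
      exact Finset.one_lt_card.mpr ⟨w, by simpa using hw, i, by simpa using hi, hwi⟩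
    · exact (StarForest.mem_centres _).mpr (hbig i hi).1

lemma exists_starForest_of_matching (hG : G.Connected) {a₁ b₁ a₂ b₂ a₃ b₃ : V}
    (h₁ : G.Adj a₁ b₁) (h₂ : G.Adj a₂ b₂) (h₃ : G.Adj a₃ b₃)
    (hd : [a₁, b₁, a₂, b₂, a₃, b₃].Nodup) : ∃ F : StarForest G, 3 ≤ F.centres.card := by
  obtain ⟨z, hz⟩ : ∃ z : V → V, ∀ v, z v =
    if v = a₁ then b₁ else if v = a₂ then b₂ else if v = a₃ then b₃ else v := ⟨_, fun _ => rfl⟩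
  simp only [List.nodup_cons, List.mem_cons, List.not_mem_nil, or_false, not_or] at hd
  have hz₁ : z a₁ = b₁ := by grind
  have hz₂ : z a₂ = b₂ := by grind
  have hz₃ : z a₃ = b₃ := by grind
  have hzb₁ : z b₁ = b₁ := by grind
  have hzb₂ : z b₂ = b₂ := by grind
  have hzb₃ : z b₃ = b₃ := by grind
  have hstar : IsStarMap G z := ⟨by grind, by grind⟩
  obtain ⟨F, hF⟩ := hstar.exists_starForest hG (I := {b₁, b₂, b₃}) (by simp) (by
    simp only [Finset.mem_insert, Finset.mem_singleton]
    rintro i (rfl | rfl | rfl)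
    · exact ⟨hzb₁, a₁, h₁.ne, hz₁⟩
    · exact ⟨hzb₂, a₂, h₂.ne, hz₂⟩
    · exact ⟨hzb₃, a₃, h₃.ne, hz₃⟩)
  refine ⟨F, ?_⟩
  rwa [Finset.card_eq_three.mpr ⟨b₁, b₂, b₃, by grind, by grind, by grind, rfl⟩] at hF

end IsStarMap

lemma two_star_gain {N₁ N₂ ω s : ℝ} (h₁ : 4 ≤ N₁) (h₂ : 2 ≤ N₂)
    (hω : ω = 1 - 1 / (N₁ - 1)) (hs : s = N₁⁻¹ + N₂⁻¹) :
    4 / (N₁ + N₂) < 2 - (1 - ω / 9 - s / 8)⁻¹ * (2 - 5 * ω / 9 - 3 * s / 4) := by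
  obtain ⟨a, rfl⟩ : ∃ a, N₁ = a + 4 := ⟨N₁ - 4, by ring⟩
  obtain ⟨b, rfl⟩ : ∃ b, N₂ = b + 2 := ⟨N₂ - 2, by ring⟩
  have ha : 0 ≤ a := by linarith
  have hb : 0 ≤ b := by linarith
  have h3 : a + 4 - 1 = a + 3 := by ring
  rw [h3] at hω
  have hΔ : 0 < 1 - ω / 9 - s / 8 := by
    have h4 : (a + 4)⁻¹ ≤ 1 / 2 := by
      rw [inv_le_comm₀ (by linarith) (by norm_num)]; linarith
    have h5 : (b + 2)⁻¹ ≤ 1 / 2 := by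
      rw [inv_le_comm₀ (by linarith) (by norm_num)]; linarith
    have h6 : 0 ≤ 1 / (a + 3) := by positivity
    linarith
  rw [lt_sub_iff_add_lt, ← lt_sub_iff_add_lt', inv_mul_lt_iff₀ hΔ, hω, hs, ← sub_pos]
  have : (1 - (1 - 1 / (a + 3)) / 9 - ((a + 4)⁻¹ + (b + 2)⁻¹) / 8) * (2 - 4 / (a + 4 + (b + 2)))
      - (2 - 5 * (1 - 1 / (a + 3)) / 9 - 3 * ((a + 4)⁻¹ + (b + 2)⁻¹) / 4) =
      (10560 + a * 34880 + a * b * 9376 + a * b ^ 2 * 6336 + a * b ^ 3 * 720 + a ^ 2 * 20880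
        + a ^ 2 * b * 7024 + a ^ 2 * b ^ 2 * 1904 + a ^ 2 * b ^ 3 * 96 + a ^ 3 * 4576
        + a ^ 3 * b * 1520 + a ^ 3 * b ^ 2 * 192 + a ^ 4 * 336 + a ^ 4 * b * 96
        + b * (6160 * b - 4480) + b ^ 3 * 1200) /
        (288 * (a + 3) * (a + 4) * (b + 2) * (a + b + 6) ^ 2) := by
    field_simp
    ring
  rw [this]
  have hb' : 0 < 10560 + b * (6160 * b - 4480) := by nlinarith [sq_nonneg (b - 1)]
  refine div_pos ?_ (by positivity)
  have : 0 ≤ a * 34880 + a * b * 9376 + a * b ^ 2 * 6336 + a * b ^ 3 * 720 + a ^ 2 * 20880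
        + a ^ 2 * b * 7024 + a ^ 2 * b ^ 2 * 1904 + a ^ 2 * b ^ 3 * 96 + a ^ 3 * 4576
        + a ^ 3 * b * 1520 + a ^ 3 * b ^ 2 * 192 + a ^ 4 * 336 + a ^ 4 * b * 96
        + b ^ 3 * 1200 := by positivity
  linarith

namespace StarForest

variable {V : Type} [Fintype V] [DecidableEq V] {G : SimpleGraph V}
  (F : StarForest G)

lemma sq_sub_leafMean_le (x : V → ℝ) {i l : V} (hi : i ∈ F.centres) (hl : F.z l = i)
    (hli : l ≠ i) (hN : 3 ≤ F.size i) :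
    (x l - (∑ v ∈ (F.star i).erase i, x v) / (F.size i - 1)) ^ 2 ≤
      (1 - 1 / (F.size i - 1)) * F.leafDev x i := by
  have hlm : l ∈ (F.star i).erase i := by simp [hl, hli]
  have hcard : ((((F.star i).erase i).erase l).card : ℝ) = F.size i - 2 := by
    rw [Finset.card_erase_of_mem hlm, Nat.cast_pred (Finset.card_pos.mpr ⟨l, hlm⟩),
      F.card_leaves hi]
    ring
  have h1 := sq_sum_le_card_mul_sum_sq (s := ((F.star i).erase i).erase l) (f := x)
  rw [hcard] at h1
  rw [leafDev, ← Finset.sum_erase_add _ _ hlm, ← Finset.sum_erase_add _ _ hlm]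
  set A := ∑ v ∈ ((F.star i).erase i).erase l, x v
  set Q := ∑ v ∈ ((F.star i).erase i).erase l, x v ^ 2
  have h2 : F.size i - 1 ≠ 0 := by linarith
  rw [← sub_nonneg]
  have : (1 - 1 / (F.size i - 1)) * (Q + x l ^ 2 - (A + x l) ^ 2 / (F.size i - 1))
      - (x l - (A + x l) / (F.size i - 1)) ^ 2 =
      ((F.size i - 2) * Q - A ^ 2) / (F.size i - 1) := by
    field_simp
    ring
  rw [this]
  exact div_nonneg (by linarith) (by linarith)

/-- The vector representing the deviation at the leaf `l` from the average over the leaves of the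
star with centre `i`. -/
noncomputable def leafVec (l i : V) : V → ℝ :=
  Pi.single l 1 - fun v => if v ∈ (F.star i).erase i then (F.size i - 1)⁻¹ else 0

lemma dotProduct_leafVec (x : V → ℝ) (l i : V) :
    x ⬝ᵥ F.leafVec l i = x l - (∑ v ∈ (F.star i).erase i, x v) / (F.size i - 1) := by
  have h : ∑ v, x v * (if v ∈ (F.star i).erase i then (F.size i - 1)⁻¹ else 0) =
      ∑ v ∈ (F.star i).erase i, x v * (F.size i - 1)⁻¹ := by
    simp_rw [mul_ite, mul_zero]
    rw [Finset.sum_ite_mem, Finset.univ_inter]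
  rw [leafVec, dotProduct_sub, dotProduct_single, mul_one, div_eq_mul_inv, Finset.sum_mul, ← h]
  rfl

lemma mean_leafVec {l i : V} (j : V) (hi : i ∈ F.centres) (hl : F.z l = i) (hN : 3 ≤ F.size i) :
    F.mean (F.leafVec l i) j = 0 := by
  rw [← dotProduct_meanVec, dotProduct_comm, dotProduct_leafVec,
    Finset.sum_congr rfl (g := fun _ => F.meanVec j l) fun v hv => ?_, Finset.sum_const,
    nsmul_eq_mul, F.card_leaves hi, mul_div_cancel_left₀ _ (by linarith), sub_self]
  have : F.z v = i := by simpa using Finset.mem_of_mem_erase hv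
  simp [meanVec, this, hl]

lemma leafVec_apply_of_ne {l i v : V} (hl : F.z l = i) (hv : F.z v ≠ i) : F.leafVec l i v = 0 := by
  have : v ≠ l := fun h => hv (h ▸ hl)
  simp [leafVec, this, hv]

lemma leafVec_apply_self {l i : V} (hl : F.z l = i) (hli : l ≠ i) :
    F.leafVec l i l = 1 - (F.size i - 1)⁻¹ := by
  simp [leafVec, hl, hli]

lemma leafVec_dotProduct_self {l i : V} (hi : i ∈ F.centres) (hl : F.z l = i)
    (hli : l ≠ i) (hN : 3 ≤ F.size i) :
    F.leafVec l i ⬝ᵥ F.leafVec l i = 1 - 1 / (F.size i - 1) := by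
  have hlm : l ∈ (F.star i).erase i := by simp [hl, hli]
  have h : ∑ v ∈ (F.star i).erase i, F.leafVec l i v = 0 := by
    have h0 : ∀ v ∈ (F.star i).erase i,
        F.leafVec l i v = (if v = l then 1 else 0) - (F.size i - 1)⁻¹ := fun v hv => by
      simp only [leafVec, Pi.sub_apply, if_pos hv, Pi.single_apply]
    rw [Finset.sum_congr rfl h0, Finset.sum_sub_distrib, Finset.sum_ite_eq', if_pos hlm,
      Finset.sum_const, nsmul_eq_mul, F.card_leaves hi, mul_inv_cancel₀ (by linarith), sub_self]
  rw [dotProduct_leafVec, h, F.leafVec_apply_self hl hli, zero_div, sub_zero, one_div]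

end StarForest

lemma sq_add_div_add_le {x y a b : ℝ} (ha : 0 < a) (hb : 0 < b) :
    (x + y) ^ 2 / (a + b) ≤ x ^ 2 / a + y ^ 2 / b := by
  have : x ^ 2 / a + y ^ 2 / b - (x + y) ^ 2 / (a + b) =
      (b * x - a * y) ^ 2 / (a * b * (a + b)) := by
    field_simp
    ring
  have h : 0 ≤ (b * x - a * y) ^ 2 / (a * b * (a + b)) := by positivity
  linarith

namespace StarForest

variable {V : Type} [Fintype V] [DecidableEq V] {G : SimpleGraph V}
  (F : StarForest G)

lemma edgeVec_dotProduct_self {a b : V} (hab : a ≠ b) :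
    edgeVec a b ⬝ᵥ edgeVec a b = 2 := by
  rw [dotProduct_edgeVec, edgeVec_apply, edgeVec_apply]
  simp [hab, hab.symm]
  norm_num

lemma Sk_lt_of_two_stars [DecidableRel G.Adj] {i j l b : V} (hij : i ≠ j)
    (hc : F.centres = {i, j}) (hi : 4 ≤ F.size i) (hl : F.z l = i) (hli : l ≠ i)
    (hb : F.z b = j) (hlb : G.Adj l b) {k : ℕ} (hk : k ≤ Fintype.card V) :
    Sk G k < 2 * G.edgeFinset.card - Fintype.card V + 2 * k - 4 / Fintype.card V := by
  have hiC : i ∈ F.centres := by simp [hc]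
  have hjC : j ∈ F.centres := by simp [hc]
  have hj := F.two_le_size hjC
  have hcard : (Fintype.card V : ℝ) = F.size i + F.size j := by
    rw [← F.sum_size, hc, Finset.sum_pair hij]
  obtain ⟨ω, hω⟩ : ∃ ω, ω = 1 - 1 / (F.size i - 1) := ⟨_, rfl⟩
  obtain ⟨s, hs⟩ : ∃ s, s = (F.size i)⁻¹ + (F.size j)⁻¹ := ⟨_, rfl⟩
  have hω0 : 0 < ω := by
    rw [hω, sub_pos, div_lt_one (by linarith)]
    linarith
  have hω1 : ω ≤ 1 := by
    have : 0 ≤ 1 / (F.size i - 1) := div_nonneg zero_le_one (by linarith)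
    linarith
  have hs0 : 0 < s := by rw [hs]; positivity
  have hs1 : s ≤ 1 := by
    have h4 : (F.size i)⁻¹ ≤ 1 / 2 := by
      rw [inv_le_comm₀ (by linarith) (by norm_num)]; linarith
    have h5 : (F.size j)⁻¹ ≤ 1 / 2 := by
      rw [inv_le_comm₀ (by linarith) (by norm_num)]; linarith
    linarith
  have hΔ : 0 < 1 - ω / 9 - s / 8 := by linarith
  have hgain := two_star_gain hi hj hω hs
  rw [← hcard] at hgain
  have hzlb : F.z l ≠ F.z b := by rwa [hl, hb]
  let o := F.leafVec l i
  let d := F.meanVec i - F.meanVec j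
  let e := edgeVec l b
  let r := e - (1 / 3 : ℝ) • o - (1 / 2 : ℝ) • d
  have hee : e ⬝ᵥ e = 2 := edgeVec_dotProduct_self hlb.ne
  have hoo : o ⬝ᵥ o = ω := by
    rw [F.leafVec_dotProduct_self hiC hl hli (by linarith), hω]
  have hdd : d ⬝ᵥ d = s := by
    simp only [d, sub_dotProduct, dotProduct_sub, F.meanVec_dotProduct_meanVec hiC,
      F.meanVec_dotProduct_meanVec hjC, hij, hij.symm, if_true, if_false, hs]
    ring
  have heo : o ⬝ᵥ e = ω := by
    rw [dotProduct_edgeVec]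
    simp only [o]
    rw [F.leafVec_apply_self hl hli, F.leafVec_apply_of_ne hl (by rw [hb]; exact hij.symm), hω, one_div, sub_zero]
  have hde : d ⬝ᵥ e = s := by
    rw [dotProduct_edgeVec]
    simp [d, meanVec, hl, hb, hij, hij.symm, hs]
  have hod : o ⬝ᵥ d = 0 := by
    simp only [d, dotProduct_sub, dotProduct_meanVec]
    rw [F.mean_leafVec i hiC hl (by linarith), F.mean_leafVec j hiC hl (by linarith), sub_zero]
  have hrr : r ⬝ᵥ r = 2 - 5 * ω / 9 - 3 * s / 4 := by
    simp only [r, sub_dotProduct, dotProduct_sub, smul_dotProduct, dotProduct_smul, smul_eq_mul,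
      hee, hoo, hdd, heo, hde, hod, dotProduct_comm e o, dotProduct_comm e d, dotProduct_comm d o]
    ring
  have hSk := F.Sk_le hk (c := 2) (fun v hv => F.two_le_size hv) {s(l, b)}
    (by simpa using F.mem_rest hlb hzlb)
    ((traceLE_sq r).const_mul (inv_nonneg.mpr hΔ.le)) fun x => ?_
  · rw [hrr] at hSk
    norm_num at hSk hgain ⊢
    linarith
  · rw [Finset.sum_singleton, edgeSq_mk, ← dotProduct_edgeVec, hc, Finset.sum_pair hij,
      Finset.sum_pair hij]
    have hO := F.sq_sub_leafMean_le x hiC hl hli (by linarith)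
    rw [← dotProduct_leafVec, ← hω, mul_comm, ← div_le_iff₀ hω0] at hO
    have hj0 := F.leafDev_nonneg x hjC
    have hD := sq_add_div_add_le (x := F.mean x i) (y := - F.mean x j)
      (a := (F.size i)⁻¹) (b := (F.size j)⁻¹) (by positivity) (by positivity)
    rw [← hs, ← sub_eq_add_neg, ← dotProduct_meanVec, ← dotProduct_meanVec, ← dotProduct_sub,
      neg_sq, div_inv_eq_mul, div_inv_eq_mul, dotProduct_meanVec, dotProduct_meanVec] at hD
    change (x ⬝ᵥ o) ^ 2 / ω ≤ _ at hO
    change (x ⬝ᵥ d) ^ 2 / s ≤ _ at hD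
    have hr : x ⬝ᵥ e = (x ⬝ᵥ r + x ⬝ᵥ o / 3) + x ⬝ᵥ d / 2 := by
      simp only [r, dotProduct_sub, dotProduct_smul, smul_eq_mul]
      ring
    change (x ⬝ᵥ e) ^ 2 ≤ _
    have h1 := sq_add_div_add_le (x := x ⬝ᵥ r) (y := x ⬝ᵥ o / 3) hΔ (by positivity : 0 < ω / 9)
    have h2 := sq_add_div_add_le (x := x ⬝ᵥ r + x ⬝ᵥ o / 3) (y := x ⬝ᵥ d / 2)
      (by positivity : 0 < 1 - ω / 9 - s / 8 + ω / 9) (by positivity : 0 < s / 8)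
    rw [show 1 - ω / 9 - s / 8 + ω / 9 + s / 8 = 1 by ring, div_one, ← hr] at h2
    have h3 : (x ⬝ᵥ o / 3) ^ 2 / (ω / 9) = (x ⬝ᵥ o) ^ 2 / ω := by field_simp; ring
    have h4 : (x ⬝ᵥ d / 2) ^ 2 / (s / 8) = 2 * ((x ⬝ᵥ d) ^ 2 / s) := by field_simp; ring
    have h5 : (1 - ω / 9 - s / 8)⁻¹ * (x ⬝ᵥ r) ^ 2 = (x ⬝ᵥ r) ^ 2 / (1 - ω / 9 - s / 8) :=
      (div_eq_inv_mul _ _).symm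
    rw [h3] at h1
    rw [h4] at h2
    rw [h5]
    linarith

end StarForest

section Graph

variable {V : Type} [Fintype V] [DecidableEq V] {G : SimpleGraph V}

/-- There is a matching with three edges. -/
def HasThreeMatching {V : Type} (G : SimpleGraph V) : Prop :=
  ∃ a₁ b₁ a₂ b₂ a₃ b₃, G.Adj a₁ b₁ ∧ G.Adj a₂ b₂ ∧ G.Adj a₃ b₃ ∧ [a₁, b₁, a₂, b₂, a₃, b₃].Nodup

omit [Fintype V] [DecidableEq V] in
lemma exists_path_of_diam (hG : G.Connected) (hd : 4 ≤ G.diam) : ∃ p₀ p₁ p₂ p₃ p₄,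
    G.Adj p₀ p₁ ∧ G.Adj p₁ p₂ ∧ G.Adj p₂ p₃ ∧ G.Adj p₃ p₄ ∧ [p₀, p₁, p₂, p₃, p₄].Nodup := by
  have := hG.nonempty
  obtain ⟨u, v, huv⟩ := G.exists_dist_eq_diam
  obtain ⟨p, hp, hlen⟩ := hG.exists_path_of_dist u v
  have h4 : 4 ≤ p.length := by omega
  have hinj := hp.getVert_injOn
  refine ⟨p.getVert 0, p.getVert 1, p.getVert 2, p.getVert 3, p.getVert 4,
    p.adj_getVert_succ (by omega), p.adj_getVert_succ (by omega), p.adj_getVert_succ (by omega),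
    p.adj_getVert_succ (by omega), ?_⟩
  have : [p.getVert 0, p.getVert 1, p.getVert 2, p.getVert 3, p.getVert 4] =
      [0, 1, 2, 3, 4].map p.getVert := rfl
  rw [this]
  refine List.Nodup.map_on (fun a ha b hb hab => hinj ?_ ?_ hab) (by decide)
  · simp at ha ⊢; omega
  · simp at hb ⊢; omega

omit [Fintype V] [DecidableEq V] in
lemma adj_or_adj_of_not_hasThreeMatching (hG : G.Connected) (hM : ¬ HasThreeMatching G)
    {p₀ p₁ p₂ p₃ p₄ : V} (h₀₁ : G.Adj p₀ p₁) (h₁₂ : G.Adj p₁ p₂) (h₂₃ : G.Adj p₂ p₃)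
    (h₃₄ : G.Adj p₃ p₄) (hp : [p₀, p₁, p₂, p₃, p₄].Nodup) {v : V}
    (hv : v ∉ [p₀, p₁, p₂, p₃, p₄]) : G.Adj v p₁ ∨ G.Adj v p₃ := by
  have hne : v ≠ p₀ := fun h => hv (by simp [h])
  have : Nontrivial V := ⟨v, p₀, hne⟩
  obtain ⟨u, hu⟩ := hG.preconnected.exists_adj_of_nontrivial v
  simp only [List.nodup_cons, List.mem_cons, List.not_mem_nil, or_false, not_or] at hp hv
  by_contra! h
  refine hM ?_
  by_cases hu0 : u = p₀
  · refine ⟨v, p₀, p₁, p₂, p₃, p₄, hu0 ▸ hu, h₁₂, h₃₄, ?_⟩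
    simp
    tauto
  by_cases hu4 : u = p₄
  · refine ⟨v, p₄, p₀, p₁, p₂, p₃, hu4 ▸ hu, h₀₁, h₂₃, ?_⟩
    simp
    tauto
  have hu1 : u ≠ p₁ := fun h' => h.1 (h' ▸ hu)
  have hu3 : u ≠ p₃ := fun h' => h.2 (h' ▸ hu)
  refine ⟨v, u, p₀, p₁, p₃, p₄, hu, h₀₁, h₃₄, ?_⟩
  have := hu.ne
  simp
  tauto

lemma exists_two_stars {p₀ p₁ p₂ p₃ p₄ : V} (h₀₁ : G.Adj p₀ p₁) (h₁₂ : G.Adj p₁ p₂)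
    (h₃₄ : G.Adj p₃ p₄) (hp : [p₀, p₁, p₂, p₃, p₄].Nodup)
    (hadj : ∀ v, v ∉ [p₀, p₁, p₂, p₃, p₄] → G.Adj v p₁ ∨ G.Adj v p₃)
    {q : V} (hq : q ∉ [p₀, p₁, p₂, p₃, p₄]) (hq1 : G.Adj q p₁) :
    ∃ F : StarForest G, F.centres = {p₁, p₃} ∧ 4 ≤ F.size p₁ ∧ F.z p₂ = p₁ ∧ F.z p₃ = p₃ := by
  classical
  obtain ⟨z, hz⟩ : ∃ z : V → V, ∀ v, z v =
    if v = p₃ ∨ v = p₄ ∨ (v ≠ p₀ ∧ v ≠ p₁ ∧ v ≠ p₂ ∧ ¬ G.Adj v p₁) then p₃ else p₁ :=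
    ⟨_, fun _ => rfl⟩
  have hne := hq1.ne
  simp only [List.nodup_cons, List.mem_cons, List.not_mem_nil, or_false, not_or] at hp hq hadj
  have z0 : z p₀ = p₁ := by rw [hz, if_neg]; tauto
  have z1 : z p₁ = p₁ := by rw [hz, if_neg]; tauto
  have z2 : z p₂ = p₁ := by rw [hz, if_neg]; tauto
  have z3 : z p₃ = p₃ := by rw [hz, if_pos]; tauto
  have z4 : z p₄ = p₃ := by rw [hz, if_pos]; tauto
  have zq : z q = p₁ := by rw [hz, if_neg]; tauto
  have hrange : ∀ v, z v = p₁ ∨ z v = p₃ := fun v => by rw [hz]; split_ifs <;> simp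
  have hfix : ∀ i, z i = i ↔ i = p₁ ∨ i = p₃ := fun i =>
    ⟨fun h => by rcases hrange i with h' | h' <;> rw [h] at h' <;> simp [h'],
      fun h => by rcases h with rfl | rfl <;> assumption⟩
  have hsub1 : ({p₀, p₁, p₂, q} : Finset V) ⊆ Finset.univ.filter fun v => z v = p₁ := by
    intro v hv
    simp only [Finset.mem_insert, Finset.mem_singleton] at hv
    rcases hv with rfl | rfl | rfl | rfl <;> simpa
  have hsub3 : ({p₃, p₄} : Finset V) ⊆ Finset.univ.filter fun v => z v = p₃ := by
    intro v hv
    simp only [Finset.mem_insert, Finset.mem_singleton] at hv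
    rcases hv with rfl | rfl <;> simpa
  have hc1 := Finset.card_le_card hsub1
  have hc3 := Finset.card_le_card hsub3
  rw [Finset.card_pair (by tauto)] at hc3
  have h4 : ({p₀, p₁, p₂, q} : Finset V).card = 4 := by
    rw [Finset.card_insert_of_notMem, Finset.card_insert_of_notMem, Finset.card_pair] <;> simp <;>
      tauto
  rw [h4] at hc1
  refine ⟨⟨z, ?_, ?_, ?_⟩, ?_, ?_, z2, z3⟩
  · intro v
    rcases hrange v with h | h <;> rw [h] <;> assumption
  · intro v hv
    have hv' := mt (hfix v).mpr hv
    rw [hz v] at hv ⊢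
    by_cases v0 : v = p₀
    · subst v0; rw [← hz, z0]; exact h₀₁
    by_cases v2 : v = p₂
    · subst v2; rw [← hz, z2]; exact h₁₂.symm
    by_cases v4 : v = p₄
    · subst v4; rw [← hz, z4]; exact h₃₄.symm
    have := hadj v
    split_ifs <;> tauto
  · intro i hi
    rcases (hfix i).mp hi with rfl | rfl
    · omega
    · exact hc3
  · ext i
    simp [hfix]
  · rw [StarForest.size, StarForest.star]
    exact_mod_cast hc1

variable [DecidableRel G.Adj]

lemma Sk_lt_of_not_hasThreeMatching (hG : G.Connected) (hn : 6 ≤ Fintype.card V)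
    (hd : 4 ≤ G.diam) (hM : ¬ HasThreeMatching G) {k : ℕ} (hk : k ≤ Fintype.card V) :
    Sk G k < 2 * G.edgeFinset.card - Fintype.card V + 2 * k - 2 * k / Fintype.card V := by
  obtain ⟨F, i, j, l, hij, hc, hi, hl, hj, hlj⟩ : ∃ (F : StarForest G) (i j l : V), i ≠ j ∧
      F.centres = {i, j} ∧ 4 ≤ F.size i ∧ F.z l = i ∧ F.z j = j ∧ G.Adj l j ∧ l ≠ i := by
    obtain ⟨p₀, p₁, p₂, p₃, p₄, h₀₁, h₁₂, h₂₃, h₃₄, hp⟩ := exists_path_of_diam hG hd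
    have hadj : ∀ v, v ∉ [p₀, p₁, p₂, p₃, p₄] → G.Adj v p₁ ∨ G.Adj v p₃ := fun v hv =>
      adj_or_adj_of_not_hasThreeMatching hG hM h₀₁ h₁₂ h₂₃ h₃₄ hp hv
    obtain ⟨q, hq⟩ : ∃ q, q ∉ [p₀, p₁, p₂, p₃, p₄] := by
      have h5 : [p₀, p₁, p₂, p₃, p₄].toFinset.card < (Finset.univ : Finset V).card :=
        (List.toFinset_card_le _).trans_lt hn
      obtain ⟨q, -, hq⟩ := Finset.exists_mem_notMem_of_card_lt_card h5
      exact ⟨q, by simpa using hq⟩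
    have hne : p₁ ≠ p₃ := by simp at hp; tauto
    rcases hadj q hq with h | h
    · obtain ⟨F, hc, hi, hl, hj⟩ := exists_two_stars h₀₁ h₁₂ h₃₄ hp hadj hq h
      exact ⟨F, p₁, p₃, p₂, hne, hc, hi, hl, hj, h₂₃, h₁₂.ne'⟩
    · have hmem : ∀ v, v ∉ [p₄, p₃, p₂, p₁, p₀] ↔ v ∉ [p₀, p₁, p₂, p₃, p₄] := fun v => by
        simp; tauto
      obtain ⟨F, hc, hi, hl, hj⟩ := exists_two_stars h₃₄.symm h₂₃.symm h₀₁.symm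
        (by simpa using List.nodup_reverse.mpr hp)
        (fun v hv => (hadj v ((hmem v).mp hv)).symm) ((hmem q).mpr hq) h
      exact ⟨F, p₃, p₁, p₂, hne.symm, hc, hi, hl, hj, h₁₂.symm, h₂₃.ne⟩
  have hn' : (6 : ℝ) ≤ Fintype.card V := by exact_mod_cast hn
  rcases le_or_gt k 2 with hk2 | hk2
  · refine (F.Sk_lt_of_two_stars hij hc hi hl hlj.2 hj hlj.1 hk).trans_le ?_
    have hk2' : (k : ℝ) ≤ 2 := by exact_mod_cast hk2
    gcongr
    linarith
  · have hcard : F.centres.card = 2 := by rw [hc, Finset.card_pair hij]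
    refine (F.Sk_lt_of_connected hG hcard.ge hk le_rfl
      fun v hv => by linarith [F.two_le_size hv]).trans_le ?_
    have hk3 : (3 : ℝ) ≤ k := by exact_mod_cast hk2
    rw [hcard, ← sub_nonneg]
    have : (2 * (G.edgeFinset.card : ℝ) - Fintype.card V + 2 * k - 2 * k / Fintype.card V) -
        (2 * G.edgeFinset.card - Fintype.card V + (2 - 1) * (2 : ℕ) + 1 * k
          - 1 / (1 + 2) * ((2 : ℕ) ^ 2 / Fintype.card V)) =
        (Fintype.card V * (k - 2) - 2 * k + 4 / 3) / Fintype.card V := by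
      field_simp
      push_cast
      ring
    rw [this]
    refine div_nonneg ?_ (by linarith)
    nlinarith

namespace StarForest

variable (F : StarForest G)

/-- All cases but that of three stars and `k = 3`. -/
lemma Sk_lt_of_three_le_card (hG : G.Connected) (ht : 3 ≤ F.centres.card) {k : ℕ}
    (hk : k ≤ Fintype.card V) (h3 : ¬ (F.centres.card = 3 ∧ k = 3)) :
    Sk G k < 2 * G.edgeFinset.card - Fintype.card V + 2 * k - 2 * k / Fintype.card V := by
  have hn := F.two_mul_card_centres_le
  have ht' : (3 : ℝ) ≤ F.centres.card := by exact_mod_cast ht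
  have hn0 : (0 : ℝ) < Fintype.card V := by linarith
  rcases lt_or_ge F.centres.card k with hkt | hkt
  · refine (F.Sk_lt_of_connected hG (by omega) hk le_rfl
      fun v hv => by linarith [F.two_le_size hv]).trans_le ?_
    have hk' : (F.centres.card : ℝ) + 1 ≤ k := by exact_mod_cast hkt
    set t : ℝ := (F.centres.card : ℝ)
    rw [← sub_nonneg]
    have : (2 * (G.edgeFinset.card : ℝ) - Fintype.card V + 2 * k - 2 * k / Fintype.card V) -
        (2 * G.edgeFinset.card - Fintype.card V + (2 - 1) * t + 1 * k
          - 1 / (1 + 2) * (t ^ 2 / Fintype.card V)) =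
        (Fintype.card V * (k - t) - 2 * k + t ^ 2 / 3) / Fintype.card V := by
      field_simp
      ring
    rw [this]
    refine div_nonneg ?_ hn0.le
    nlinarith
  · refine (F.Sk_lt_of_connected hG (by omega) hk one_le_two
      fun v hv => F.two_le_size hv).trans_le ?_
    have h : 4 * (k : ℝ) ≤ (F.centres.card : ℝ) ^ 2 := by
      have : 4 * k ≤ F.centres.card ^ 2 := by
        rcases ht.eq_or_lt with h | h
        · rw [← h] at hkt h3 ⊢
          omega
        · nlinarith
      exact_mod_cast this
    set t : ℝ := (F.centres.card : ℝ)
    rw [← sub_nonneg]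
    have : (2 * (G.edgeFinset.card : ℝ) - Fintype.card V + 2 * k - 2 * k / Fintype.card V) -
        (2 * G.edgeFinset.card - Fintype.card V + (2 - 2) * t + 2 * k
          - 2 / (2 + 2) * (t ^ 2 / Fintype.card V)) =
        (t ^ 2 / 2 - 2 * k) / Fintype.card V := by
      field_simp
      ring
    rw [this]
    exact div_nonneg (by linarith) hn0.le

end StarForest

end Graph

lemma sq_add_sq_le_of_posDef {c α β N₁ N₂ N₃ X₁₁ X₁₂ X₂₂ Δ₁₁ Δ₁₂ Δ₂₂ : ℝ} (hc : 0 < c)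
    (hN₁ : 0 < N₁) (hN₂ : 0 < N₂) (hN₃ : 0 < N₃)
    (hX₁₁ : X₁₁ = α ^ 2 * N₁⁻¹ + (α + β) ^ 2 * N₂⁻¹ + β ^ 2 * N₃⁻¹)
    (hX₁₂ : X₁₂ = α * β * N₁⁻¹ + (α + β) ^ 2 * N₂⁻¹ + α * β * N₃⁻¹)
    (hX₂₂ : X₂₂ = β ^ 2 * N₁⁻¹ + (α + β) ^ 2 * N₂⁻¹ + α ^ 2 * N₃⁻¹)
    (hΔ₁₁ : Δ₁₁ = 1 - X₁₁ / c) (hΔ₁₂ : Δ₁₂ = - (X₁₂ / c)) (hΔ₂₂ : Δ₂₂ = 1 - X₂₂ / c)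
    (h₂₂ : 0 < Δ₂₂) (hdet : 0 < Δ₁₁ * Δ₂₂ - Δ₁₂ ^ 2) {p q m₁ m₂ m₃ r₁ r₂ : ℝ}
    (hr₁ : r₁ = p - (α * (m₁ - m₂) + β * (m₃ - m₂)))
    (hr₂ : r₂ = q - (β * (m₁ - m₂) + α * (m₃ - m₂))) :
    p ^ 2 + q ^ 2 ≤ c * (N₁ * m₁ ^ 2 + N₂ * m₂ ^ 2 + N₃ * m₃ ^ 2) +
      ((Δ₂₂ * (Δ₁₁ * Δ₂₂ - Δ₁₂ ^ 2))⁻¹ * (Δ₂₂ * r₁ - Δ₁₂ * r₂) ^ 2 + Δ₂₂⁻¹ * r₂ ^ 2) := by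
  have hA : 2 * (p * r₁ + q * r₂) - (p ^ 2 * Δ₁₁ + 2 * p * q * Δ₁₂ + q ^ 2 * Δ₂₂) ≤
      (Δ₂₂ * (Δ₁₁ * Δ₂₂ - Δ₁₂ ^ 2))⁻¹ * (Δ₂₂ * r₁ - Δ₁₂ * r₂) ^ 2 + Δ₂₂⁻¹ * r₂ ^ 2 := by
    set d := Δ₁₁ * Δ₂₂ - Δ₁₂ ^ 2 with hd
    have hΔ : Δ₁₁ = (d + Δ₁₂ ^ 2) / Δ₂₂ := by
      rw [hd]
      field_simp
      ring
    have h : (Δ₂₂ * d)⁻¹ * (Δ₂₂ * r₁ - Δ₁₂ * r₂) ^ 2 + Δ₂₂⁻¹ * r₂ ^ 2 -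
        (2 * (p * r₁ + q * r₂) - (p ^ 2 * Δ₁₁ + 2 * p * q * Δ₁₂ + q ^ 2 * Δ₂₂)) =
        (Δ₂₂ * d)⁻¹ * (Δ₂₂ * r₁ - Δ₁₂ * r₂ - d * p) ^ 2
          + Δ₂₂⁻¹ * (r₂ - Δ₁₂ * p - Δ₂₂ * q) ^ 2 := by
      rw [hΔ]
      clear_value d
      field_simp
      ring
    have : 0 ≤ (Δ₂₂ * d)⁻¹ * (Δ₂₂ * r₁ - Δ₁₂ * r₂ - d * p) ^ 2
          + Δ₂₂⁻¹ * (r₂ - Δ₁₂ * p - Δ₂₂ * q) ^ 2 := by positivity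
    linarith
  have hB (N m s : ℝ) (hN : 0 < N) : 2 * (s * m) - N⁻¹ * s ^ 2 / c ≤ c * (N * m ^ 2) := by
    have h : c * (N * m ^ 2) - (2 * (s * m) - N⁻¹ * s ^ 2 / c) =
        c * N * (m - N⁻¹ * s / c) ^ 2 := by
      field_simp
      ring
    have : 0 ≤ c * N * (m - N⁻¹ * s / c) ^ 2 := by positivity
    linarith
  have h₁ := hB N₁ m₁ (α * p + β * q) hN₁
  have h₂ := hB N₂ m₂ (-((α + β) * (p + q))) hN₂
  have h₃ := hB N₃ m₃ (β * p + α * q) hN₃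
  have h : p ^ 2 + q ^ 2 =
      2 * (p * r₁ + q * r₂) - (p ^ 2 * Δ₁₁ + 2 * p * q * Δ₁₂ + q ^ 2 * Δ₂₂) +
      (2 * ((α * p + β * q) * m₁) - N₁⁻¹ * (α * p + β * q) ^ 2 / c +
      (2 * (-((α + β) * (p + q)) * m₂) - N₂⁻¹ * (-((α + β) * (p + q))) ^ 2 / c) +
      (2 * ((β * p + α * q) * m₃) - N₃⁻¹ * (β * p + α * q) ^ 2 / c)) := by
    rw [hΔ₁₁, hΔ₁₂, hΔ₂₂, hX₁₁, hX₁₂, hX₂₂, hr₁, hr₂]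
    field_simp
    ring
  linarith

namespace StarForest

variable {V : Type} [Fintype V] [DecidableEq V] {G : SimpleGraph V}
  (F : StarForest G)

lemma Sk_le_of_two_edges [DecidableRel G.Adj] {i j l x y x' y' : V} (hij : i ≠ j) (hlj : l ≠ j)
    (hil : i ≠ l) (hC : F.centres = {i, j, l}) (hx : F.z x = i) (hy : F.z y = j)
    (hx' : F.z x' = l) (hy' : F.z y' = j) (hxy : G.Adj x y) (hxy' : G.Adj x' y')
    {c α β γ X₁₁ X₁₂ X₂₂ Δ₁₁ Δ₁₂ Δ₂₂ C₁₁ C₁₂ C₂₂ : ℝ} (hγ : γ = if y = y' then 1 else 0)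
    (hc1 : 1 ≤ c) (hc : ∀ v ∈ F.centres, c ≤ F.size v)
    (hX₁₁ : X₁₁ = α ^ 2 * (F.size i)⁻¹ + (α + β) ^ 2 * (F.size j)⁻¹ + β ^ 2 * (F.size l)⁻¹)
    (hX₁₂ : X₁₂ = α * β * (F.size i)⁻¹ + (α + β) ^ 2 * (F.size j)⁻¹ + α * β * (F.size l)⁻¹)
    (hX₂₂ : X₂₂ = β ^ 2 * (F.size i)⁻¹ + (α + β) ^ 2 * (F.size j)⁻¹ + α ^ 2 * (F.size l)⁻¹)
    (hΔ₁₁ : Δ₁₁ = 1 - X₁₁ / c) (hΔ₁₂ : Δ₁₂ = - (X₁₂ / c)) (hΔ₂₂ : Δ₂₂ = 1 - X₂₂ / c)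
    (hC₁₁ : C₁₁ = 2 - 2 * (α * (F.size i)⁻¹ + (α + β) * (F.size j)⁻¹) + X₁₁)
    (hC₁₂ : C₁₂ = γ - (β * (F.size i)⁻¹ + 2 * (α + β) * (F.size j)⁻¹ + β * (F.size l)⁻¹) + X₁₂)
    (hC₂₂ : C₂₂ = 2 - 2 * ((α + β) * (F.size j)⁻¹ + α * (F.size l)⁻¹) + X₂₂)
    (h₂₂ : 0 < Δ₂₂) (hdet : 0 < Δ₁₁ * Δ₂₂ - Δ₁₂ ^ 2) (hk : 3 ≤ Fintype.card V) :
    Sk G 3 ≤ 2 * G.edgeFinset.card - Fintype.card V + 6 -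
      (4 - (Δ₂₂ * C₁₁ - 2 * Δ₁₂ * C₁₂ + Δ₁₁ * C₂₂) / (Δ₁₁ * Δ₂₂ - Δ₁₂ ^ 2)) := by
  have hiC : i ∈ F.centres := by simp [hC]
  have hjC : j ∈ F.centres := by simp [hC]
  have hlC : l ∈ F.centres := by simp [hC]
  have hi := F.two_le_size hiC
  have hj := F.two_le_size hjC
  have hl := F.two_le_size hlC
  have hsum (f : V → ℝ) : ∑ v ∈ F.centres, f v = f i + f j + f l := by
    rw [hC, Finset.sum_insert (by simp [hij, hil]), Finset.sum_pair hlj.symm, add_assoc]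
  have hcard : F.centres.card = 3 := by
    rw [hC, Finset.card_insert_of_notMem (by simp [hij, hil]), Finset.card_pair hlj.symm]
  have hxx' : x ≠ x' := fun h => hil (by rw [← hx, ← hx', h])
  have hxy0 : x ≠ y := hxy.ne
  have hxy0' : x' ≠ y' := hxy'.ne
  have hxy₁ : x ≠ y' := fun h => hij (by rw [← hx, ← hy', h])
  have hxy₂ : x' ≠ y := fun h => hlj (by rw [← hx', ← hy, h])
  obtain ⟨e, he⟩ : ∃ e, e = edgeVec x y := ⟨_, rfl⟩
  obtain ⟨e', he'⟩ : ∃ e', e' = edgeVec x' y' := ⟨_, rfl⟩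
  obtain ⟨d, hd⟩ : ∃ d, d = F.meanVec i - F.meanVec j := ⟨_, rfl⟩
  obtain ⟨d', hd'⟩ : ∃ d', d' = F.meanVec l - F.meanVec j := ⟨_, rfl⟩
  have hee : e ⬝ᵥ e = 2 := by rw [he, edgeVec_dotProduct_self hxy0]
  have hee' : e' ⬝ᵥ e' = 2 := by rw [he', edgeVec_dotProduct_self hxy0']
  have hγ' : e ⬝ᵥ e' = γ := by
    rw [he, he', dotProduct_edgeVec, edgeVec_apply, edgeVec_apply, hγ]
    simp [hxx'.symm, hxy₁.symm, hxy₂, eq_comm]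
  have hdd : d ⬝ᵥ d = (F.size i)⁻¹ + (F.size j)⁻¹ := by
    simp only [hd, sub_dotProduct, dotProduct_sub, F.meanVec_dotProduct_meanVec hiC,
      F.meanVec_dotProduct_meanVec hjC, hij, hij.symm, if_true, if_false]
    ring
  have hdd' : d' ⬝ᵥ d' = (F.size j)⁻¹ + (F.size l)⁻¹ := by
    simp only [hd', sub_dotProduct, dotProduct_sub, F.meanVec_dotProduct_meanVec hlC,
      F.meanVec_dotProduct_meanVec hjC, hlj, hlj.symm, if_true, if_false]
    ring
  have hd1 : d ⬝ᵥ d' = (F.size j)⁻¹ := by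
    simp only [hd, hd', sub_dotProduct, dotProduct_sub, F.meanVec_dotProduct_meanVec hiC,
      F.meanVec_dotProduct_meanVec hjC, hij, hil, hlj.symm, if_true, if_false]
    ring
  have hed : d ⬝ᵥ e = (F.size i)⁻¹ + (F.size j)⁻¹ := by
    rw [he, dotProduct_edgeVec]
    simp [hd, meanVec, hx, hy, hij, hij.symm]
  have hed' : d' ⬝ᵥ e = (F.size j)⁻¹ := by
    rw [he, dotProduct_edgeVec]
    simp [hd', meanVec, hx, hy, hij, hil, hlj.symm]
  have he'd : d ⬝ᵥ e' = (F.size j)⁻¹ := by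
    rw [he', dotProduct_edgeVec]
    simp [hd, meanVec, hx', hy', hlj, hil.symm, hij.symm]
  have he'd' : d' ⬝ᵥ e' = (F.size j)⁻¹ + (F.size l)⁻¹ := by
    rw [he', dotProduct_edgeVec]
    simp [hd', meanVec, hx', hy', hlj, hlj.symm, add_comm]
  obtain ⟨r, hr⟩ : ∃ r, r = e - (α • d + β • d') := ⟨_, rfl⟩
  obtain ⟨r', hr'⟩ : ∃ r', r' = e' - (β • d + α • d') := ⟨_, rfl⟩
  have hrr : r ⬝ᵥ r = C₁₁ := by
    simp only [hr, sub_dotProduct, dotProduct_sub, add_dotProduct, dotProduct_add, smul_dotProduct,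
      dotProduct_smul, smul_eq_mul, dotProduct_comm e d, dotProduct_comm e d', dotProduct_comm d' d,
      hee, hdd, hdd', hd1, hed, hed', hC₁₁, hX₁₁]
    ring
  have hrr' : r ⬝ᵥ r' = C₁₂ := by
    simp only [hr, hr', sub_dotProduct, dotProduct_sub, add_dotProduct, dotProduct_add,
      smul_dotProduct, dotProduct_smul, smul_eq_mul, dotProduct_comm e d, dotProduct_comm e d',
      dotProduct_comm d' d, hγ', hdd, hdd', hd1, hed, hed', he'd, he'd', hC₁₂, hX₁₂]
    ring
  have hr'r' : r' ⬝ᵥ r' = C₂₂ := by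
    simp only [hr', sub_dotProduct, dotProduct_sub, add_dotProduct, dotProduct_add, smul_dotProduct,
      dotProduct_smul, smul_eq_mul, dotProduct_comm e' d, dotProduct_comm e' d',
      dotProduct_comm d' d, hee', hdd, hdd', hd1, he'd, he'd', hC₂₂, hX₂₂]
    ring
  set D := Δ₁₁ * Δ₂₂ - Δ₁₂ ^ 2 with hD
  have hq := ((traceLE_sq (Δ₂₂ • r - Δ₁₂ • r')).const_mul
    (inv_nonneg.mpr (mul_pos h₂₂ hdet).le)).add ((traceLE_sq r').const_mul (inv_nonneg.mpr h₂₂.le))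
  have hne : s(x, y) ≠ s(x', y') := fun h => by
    rcases Sym2.eq_iff.mp h with ⟨h, -⟩ | ⟨h, -⟩
    · exact hxx' h
    · exact hxy₁ h
  have hSk := F.Sk_le hk hc {s(x, y), s(x', y')} (by
    intro e he
    rcases Finset.mem_insert.mp he with rfl | he
    · exact F.mem_rest hxy (by rwa [hx, hy])
    · rw [Finset.mem_singleton.mp he]
      exact F.mem_rest hxy' (by rwa [hx', hy'])) hq fun u => ?_
  · rw [Finset.card_pair hne, hcard] at hSk
    have h : (Δ₂₂ * D)⁻¹ * ((Δ₂₂ • r - Δ₁₂ • r') ⬝ᵥ (Δ₂₂ • r - Δ₁₂ • r')) + Δ₂₂⁻¹ * (r' ⬝ᵥ r') =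
        (Δ₂₂ * C₁₁ - 2 * Δ₁₂ * C₁₂ + Δ₁₁ * C₂₂) / D := by
      simp only [sub_dotProduct, dotProduct_sub, smul_dotProduct, dotProduct_smul, smul_eq_mul,
        dotProduct_comm r' r, hrr, hrr', hr'r']
      have hΔ : Δ₁₁ = (D + Δ₁₂ ^ 2) / Δ₂₂ := by
        rw [hD]
        field_simp
        ring
      rw [hΔ]
      clear_value D
      field_simp
      ring
    rw [h] at hSk
    push_cast at hSk
    linarith
  · have hdev : 0 ≤ (c - 1) * ∑ v ∈ F.centres, F.leafDev u v :=
      mul_nonneg (by linarith) (Finset.sum_nonneg fun v hv => F.leafDev_nonneg u hv)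
    rw [Finset.sum_pair hne, edgeSq_mk, edgeSq_mk, hsum (fun v => F.size v * F.mean u v ^ 2),
      ← dotProduct_edgeVec, ← dotProduct_edgeVec, ← he, ← he']
    have h := sq_add_sq_le_of_posDef (c := c) (by linarith) (by linarith) (by linarith)
      (by linarith) hX₁₁ hX₁₂ hX₂₂ hΔ₁₁ hΔ₁₂ hΔ₂₂ h₂₂ hdet (p := u ⬝ᵥ e) (q := u ⬝ᵥ e')
      (m₁ := F.mean u i) (m₂ := F.mean u j) (m₃ := F.mean u l) (r₁ := u ⬝ᵥ r) (r₂ := u ⬝ᵥ r')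
      (by simp only [hr, hd, hd', dotProduct_sub, dotProduct_add, dotProduct_smul, smul_eq_mul,
        dotProduct_meanVec])
      (by simp only [hr', hd, hd', dotProduct_sub, dotProduct_add, dotProduct_smul, smul_eq_mul,
        dotProduct_meanVec])
    simp only [dotProduct_sub, dotProduct_smul, smul_eq_mul]
    linarith

end StarForest

/-- The numerator of the gain from three stars, compared with eigenvalue `2` in each star. -/
noncomputable def gainTwo (γ N₁ N₂ N₃ : ℝ) : ℝ :=
  52 * N₁ ^ 2 * N₂ + 108 * N₁ ^ 2 * N₃ - 16 * N₁ ^ 2 + 52 * N₁ * N₂ ^ 2 - 463 * N₁ * N₂ * N₃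
    + 70 * N₁ * N₂ + 108 * N₁ * N₃ ^ 2 + 76 * N₁ * N₃ - 12 * N₁ + 52 * N₂ ^ 2 * N₃ - 16 * N₂ ^ 2
    + 52 * N₂ * N₃ ^ 2 + 70 * N₂ * N₃ - 12 * N₂ - 16 * N₃ ^ 2 - 12 * N₃
    + γ * (8 * N₁ ^ 2 * N₂ - 18 * N₁ ^ 2 * N₃ + 8 * N₁ * N₂ ^ 2 - 2 * N₁ * N₂ * N₃
    - 18 * N₁ * N₃ ^ 2 + 8 * N₂ ^ 2 * N₃ + 8 * N₂ * N₃ ^ 2)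

/-- The numerator of the gain from three stars, compared with eigenvalue `3` in each star. -/
noncomputable def gainThree (γ N₁ N₂ N₃ : ℝ) : ℝ :=
  55 * N₁ ^ 2 * N₂ + 112 * N₁ ^ 2 * N₃ - 15 * N₁ ^ 2 + 55 * N₁ * N₂ ^ 2 - 354 * N₁ * N₂ * N₃
    + 48 * N₁ * N₂ + 112 * N₁ * N₃ ^ 2 + 66 * N₁ * N₃ - 9 * N₁ + 55 * N₂ ^ 2 * N₃ - 15 * N₂ ^ 2
    + 55 * N₂ * N₃ ^ 2 + 48 * N₂ * N₃ - 9 * N₂ - 15 * N₃ ^ 2 - 9 * N₃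
    + γ * (5 * N₁ ^ 2 * N₂ - 16 * N₁ ^ 2 * N₃ + 5 * N₁ * N₂ ^ 2 - 6 * N₁ * N₂ * N₃
    - 16 * N₁ * N₃ ^ 2 + 5 * N₂ ^ 2 * N₃ + 5 * N₂ * N₃ ^ 2)

lemma gainTwo_pos_of_left {γ N₂ N₃ : ℝ} (hγ : γ = 0 ∨ γ = 1) (h₂ : 2 ≤ N₂) (h₃ : 2 ≤ N₃) :
    0 < gainTwo γ 2 N₂ N₃ := by
  obtain ⟨b, rfl⟩ : ∃ b, N₂ = b + 2 := ⟨N₂ - 2, by ring⟩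
  obtain ⟨c, rfl⟩ : ∃ c, N₃ = c + 2 := ⟨N₃ - 2, by ring⟩
  have hb : 0 ≤ b := by linarith
  have hc : 0 ≤ c := by linarith
  have hbc := mul_nonneg hb hc
  unfold gainTwo
  rcases hγ with rfl | rfl <;>
  nlinarith [mul_nonneg hbc hb, mul_nonneg hbc hc, mul_nonneg hc (sq_nonneg (b - 2)),
    mul_nonneg hb (sq_nonneg (c - 1)), sq_nonneg (b - 1 - c), sq_nonneg (b - 1), sq_nonneg (b - c)]

lemma gainTwo_pos_of_middle {γ N₁ N₃ : ℝ} (hγ : γ = 0 ∨ γ = 1) (h₁ : 2 ≤ N₁) (h₃ : 2 ≤ N₃) :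
    0 < gainTwo γ N₁ 2 N₃ := by
  obtain ⟨a, rfl⟩ : ∃ a, N₁ = a + 2 := ⟨N₁ - 2, by ring⟩
  obtain ⟨c, rfl⟩ : ∃ c, N₃ = c + 2 := ⟨N₃ - 2, by ring⟩
  have ha : 0 ≤ a := by linarith
  have hc : 0 ≤ c := by linarith
  have hac := mul_nonneg ha hc
  unfold gainTwo
  rcases hγ with rfl | rfl <;>
  nlinarith [mul_nonneg hac ha, mul_nonneg hac hc, sq_nonneg (a - c)]

lemma gainTwo_comm (γ N₁ N₂ N₃ : ℝ) : gainTwo γ N₁ N₂ N₃ = gainTwo γ N₃ N₂ N₁ := by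
  unfold gainTwo
  ring

lemma gainThree_pos {γ N₁ N₂ N₃ : ℝ} (hγ : γ = 0 ∨ γ = 1) (h₁ : 3 ≤ N₁) (h₂ : 3 ≤ N₂)
    (h₃ : 3 ≤ N₃) : 0 < gainThree γ N₁ N₂ N₃ := by
  obtain ⟨a, rfl⟩ : ∃ a, N₁ = a + 3 := ⟨N₁ - 3, by ring⟩
  obtain ⟨b, rfl⟩ : ∃ b, N₂ = b + 3 := ⟨N₂ - 3, by ring⟩
  obtain ⟨c, rfl⟩ : ∃ c, N₃ = c + 3 := ⟨N₃ - 3, by ring⟩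
  have ha : 0 ≤ a := by linarith
  have hb : 0 ≤ b := by linarith
  have hc : 0 ≤ c := by linarith
  obtain ⟨s, hs⟩ : ∃ s, s = a + c := ⟨_, rfl⟩
  obtain ⟨m, hm⟩ : ∃ m, m = a * c := ⟨_, rfl⟩
  have hs0 : 0 ≤ s := by linarith
  have hm0 : 0 ≤ m := by rw [hm]; positivity
  have hms : 4 * m ≤ s ^ 2 := by
    rw [hm, hs]
    linarith [sq_nonneg (a - c), sub_sq a c, add_sq a c]
  have hbs := mul_nonneg hb hs0
  unfold gainThree
  rcases hγ with rfl | rfl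
  · have h3 : 0 ≤ 550 * b * s ^ 2 + 550 * b ^ 2 * s + m * (1120 * s - 4640 * b) := by
      rcases le_total (4640 * b) (1120 * s) with h | h
      · have := mul_nonneg hm0 (sub_nonneg.mpr h)
        positivity
      · nlinarith [mul_nonneg (sub_nonneg.mpr hms) (sub_nonneg.mpr h),
          mul_nonneg hs0 (sq_nonneg (3 * s - 4 * b))]
    have h2 : 0 ≤ 1000 * b ^ 2 - 1180 * (b * s) + 1620 * s ^ 2 - 2080 * m := by
      nlinarith [sq_nonneg (10 * b - 6 * s)]
    have h1 : 0 < 50 * b ^ 2 - 90 * b + 11340 := by nlinarith [sq_nonneg (b - 1)]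
    subst hs hm
    linarith
  · have h3 : 0 ≤ 200 * b * s ^ 2 + 200 * b ^ 2 * s + m * (320 * s - 1600 * b) := by
      rcases le_total (1600 * b) (320 * s) with h | h
      · have := mul_nonneg hm0 (sub_nonneg.mpr h)
        positivity
      · nlinarith [mul_nonneg (sub_nonneg.mpr hms) (sub_nonneg.mpr h),
          mul_nonneg hs0 (sq_nonneg (s - 2 * b)), mul_nonneg hs0 (sq_nonneg (3 * s - 4 * b))]
    have h2 : 0 ≤ 1150 * b ^ 2 - 1040 * (b * s) + 1510 * s ^ 2 - 2560 * m := by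
      nlinarith [sq_nonneg (2 * b - s)]
    subst hs hm
    linarith

lemma three_star_gain_two {γ N₁ N₂ N₃ X₁₁ X₁₂ X₂₂ Δ₁₁ Δ₁₂ Δ₂₂ C₁₁ C₁₂ C₂₂ : ℝ} (h₁ : 2 ≤ N₁)
    (h₂ : 2 ≤ N₂) (h₃ : 2 ≤ N₃) (hgain : 0 < gainTwo γ N₁ N₂ N₃)
    (hX₁₁ : X₁₁ = (8 / 15) ^ 2 * N₁⁻¹ + (8 / 15 + -2 / 15) ^ 2 * N₂⁻¹ + (-2 / 15) ^ 2 * N₃⁻¹)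
    (hX₁₂ : X₁₂ = 8 / 15 * (-2 / 15) * N₁⁻¹ + (8 / 15 + -2 / 15) ^ 2 * N₂⁻¹ + 8 / 15 * (-2 / 15) * N₃⁻¹)
    (hX₂₂ : X₂₂ = (-2 / 15) ^ 2 * N₁⁻¹ + (8 / 15 + -2 / 15) ^ 2 * N₂⁻¹ + (8 / 15) ^ 2 * N₃⁻¹)
    (hΔ₁₁ : Δ₁₁ = 1 - X₁₁ / 2) (hΔ₁₂ : Δ₁₂ = - (X₁₂ / 2)) (hΔ₂₂ : Δ₂₂ = 1 - X₂₂ / 2)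
    (hC₁₁ : C₁₁ = 2 - 2 * (8 / 15 * N₁⁻¹ + (8 / 15 + -2 / 15) * N₂⁻¹) + X₁₁)
    (hC₁₂ : C₁₂ = γ - (-2 / 15 * N₁⁻¹ + 2 * (8 / 15 + -2 / 15) * N₂⁻¹ + -2 / 15 * N₃⁻¹) + X₁₂)
    (hC₂₂ : C₂₂ = 2 - 2 * ((8 / 15 + -2 / 15) * N₂⁻¹ + 8 / 15 * N₃⁻¹) + X₂₂) :
    0 < Δ₂₂ ∧ 0 < Δ₁₁ * Δ₂₂ - Δ₁₂ ^ 2 ∧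
      (Δ₂₂ * C₁₁ - 2 * Δ₁₂ * C₁₂ + Δ₁₁ * C₂₂) / (Δ₁₁ * Δ₂₂ - Δ₁₂ ^ 2) <
        4 - 6 / (N₁ + N₂ + N₃) := by
  have hinv (N : ℝ) (hN : 2 ≤ N) : 0 < N⁻¹ ∧ N⁻¹ ≤ 1 / 2 :=
    ⟨inv_pos.mpr (by linarith), by rw [inv_le_comm₀ (by linarith) (by norm_num)]; linarith⟩
  obtain ⟨hν₁, hν₁'⟩ := hinv N₁ h₁
  obtain ⟨hν₂, hν₂'⟩ := hinv N₂ h₂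
  obtain ⟨hν₃, hν₃'⟩ := hinv N₃ h₃
  have h₁₁ : 1 / 2 ≤ Δ₁₁ := by linarith
  have h₂₂ : 1 / 2 ≤ Δ₂₂ := by linarith
  have h₁₂ : |Δ₁₂| ≤ 1 / 4 := abs_le.mpr ⟨by linarith, by linarith⟩
  have h₁₂' : Δ₁₂ ^ 2 ≤ (1 / 4) ^ 2 := sq_le_sq' (abs_le.mp h₁₂).1 (abs_le.mp h₁₂).2
  have hdet : 0 < Δ₁₁ * Δ₂₂ - Δ₁₂ ^ 2 := by nlinarith
  refine ⟨by linarith, hdet, ?_⟩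
  rw [div_lt_iff₀ hdet, ← sub_pos]
  have h : (4 - 6 / (N₁ + N₂ + N₃)) * (Δ₁₁ * Δ₂₂ - Δ₁₂ ^ 2) -
      (Δ₂₂ * C₁₁ - 2 * Δ₁₂ * C₁₂ + Δ₁₁ * C₂₂) =
      gainTwo γ N₁ N₂ N₃ / ((225 / 2) * (N₁ * N₂ * N₃ * (N₁ + N₂ + N₃))) := by
    rw [hC₁₁, hC₁₂, hC₂₂, hΔ₁₁, hΔ₁₂, hΔ₂₂, hX₁₁, hX₁₂, hX₂₂, gainTwo]
    field_simp
    ring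
  rw [h]
  positivity

lemma three_star_gain_three {γ N₁ N₂ N₃ X₁₁ X₁₂ X₂₂ Δ₁₁ Δ₁₂ Δ₂₂ C₁₁ C₁₂ C₂₂ : ℝ} (h₁ : 2 ≤ N₁)
    (h₂ : 2 ≤ N₂) (h₃ : 2 ≤ N₃) (hgain : 0 < gainThree γ N₁ N₂ N₃)
    (hX₁₁ : X₁₁ = (5 / 8) ^ 2 * N₁⁻¹ + (5 / 8 + -1 / 8) ^ 2 * N₂⁻¹ + (-1 / 8) ^ 2 * N₃⁻¹)
    (hX₁₂ : X₁₂ = 5 / 8 * (-1 / 8) * N₁⁻¹ + (5 / 8 + -1 / 8) ^ 2 * N₂⁻¹ + 5 / 8 * (-1 / 8) * N₃⁻¹)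
    (hX₂₂ : X₂₂ = (-1 / 8) ^ 2 * N₁⁻¹ + (5 / 8 + -1 / 8) ^ 2 * N₂⁻¹ + (5 / 8) ^ 2 * N₃⁻¹)
    (hΔ₁₁ : Δ₁₁ = 1 - X₁₁ / 3) (hΔ₁₂ : Δ₁₂ = - (X₁₂ / 3)) (hΔ₂₂ : Δ₂₂ = 1 - X₂₂ / 3)
    (hC₁₁ : C₁₁ = 2 - 2 * (5 / 8 * N₁⁻¹ + (5 / 8 + -1 / 8) * N₂⁻¹) + X₁₁)
    (hC₁₂ : C₁₂ = γ - (-1 / 8 * N₁⁻¹ + 2 * (5 / 8 + -1 / 8) * N₂⁻¹ + -1 / 8 * N₃⁻¹) + X₁₂)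
    (hC₂₂ : C₂₂ = 2 - 2 * ((5 / 8 + -1 / 8) * N₂⁻¹ + 5 / 8 * N₃⁻¹) + X₂₂) :
    0 < Δ₂₂ ∧ 0 < Δ₁₁ * Δ₂₂ - Δ₁₂ ^ 2 ∧
      (Δ₂₂ * C₁₁ - 2 * Δ₁₂ * C₁₂ + Δ₁₁ * C₂₂) / (Δ₁₁ * Δ₂₂ - Δ₁₂ ^ 2) <
        4 - 6 / (N₁ + N₂ + N₃) := by
  have hinv (N : ℝ) (hN : 2 ≤ N) : 0 < N⁻¹ ∧ N⁻¹ ≤ 1 / 2 :=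
    ⟨inv_pos.mpr (by linarith), by rw [inv_le_comm₀ (by linarith) (by norm_num)]; linarith⟩
  obtain ⟨hν₁, hν₁'⟩ := hinv N₁ h₁
  obtain ⟨hν₂, hν₂'⟩ := hinv N₂ h₂
  obtain ⟨hν₃, hν₃'⟩ := hinv N₃ h₃
  have h₁₁ : 1 / 2 ≤ Δ₁₁ := by linarith
  have h₂₂ : 1 / 2 ≤ Δ₂₂ := by linarith
  have h₁₂ : |Δ₁₂| ≤ 1 / 4 := abs_le.mpr ⟨by linarith, by linarith⟩
  have h₁₂' : Δ₁₂ ^ 2 ≤ (1 / 4) ^ 2 := sq_le_sq' (abs_le.mp h₁₂).1 (abs_le.mp h₁₂).2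
  have hdet : 0 < Δ₁₁ * Δ₂₂ - Δ₁₂ ^ 2 := by nlinarith
  refine ⟨by linarith, hdet, ?_⟩
  rw [div_lt_iff₀ hdet, ← sub_pos]
  have h : (4 - 6 / (N₁ + N₂ + N₃)) * (Δ₁₁ * Δ₂₂ - Δ₁₂ ^ 2) -
      (Δ₂₂ * C₁₁ - 2 * Δ₁₂ * C₁₂ + Δ₁₁ * C₂₂) =
      gainThree γ N₁ N₂ N₃ / (96 * (N₁ * N₂ * N₃ * (N₁ + N₂ + N₃))) := by
    rw [hC₁₁, hC₁₂, hC₂₂, hΔ₁₁, hΔ₁₂, hΔ₂₂, hX₁₁, hX₁₂, hX₂₂, gainThree]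
    field_simp
    ring
  rw [h]
  positivity

namespace StarForest

variable {V : Type} [Fintype V] [DecidableEq V] {G : SimpleGraph V}
  (F : StarForest G)

lemma exists_two_edges (hG : G.Connected) (ht : F.centres.card = 3) :
    ∃ i j l x y x' y', i ≠ j ∧ l ≠ j ∧ i ≠ l ∧ F.centres = {i, j, l} ∧ F.z x = i ∧ F.z y = j ∧
      F.z x' = l ∧ F.z y' = j ∧ G.Adj x y ∧ G.Adj x' y' := by
  obtain ⟨i, j, l, hij, hil, hjl, hC⟩ := Finset.card_eq_three.mp ht
  have hout (v : V) (hv : v ∈ F.centres) := F.exists_adj_of_connected hG (by omega) hv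
  have hmem (v : V) : F.z v = i ∨ F.z v = j ∨ F.z v = l := by
    simpa [hC] using F.z_mem_centres v
  obtain ⟨a, b, hab, ha, hb⟩ := hout i (by simp [hC])
  rcases (hmem b).resolve_left hb with hb | hb
  · obtain ⟨a', b', hab', ha', hb'⟩ := hout l (by simp [hC])
    rcases hmem b' with hb' | hb' | hb'
    · exact ⟨j, i, l, b, a, a', b', hij.symm, hil.symm, hjl, by rw [hC, Finset.insert_comm],
        hb, ha, ha', hb', hab.symm, hab'⟩
    · exact ⟨i, j, l, a, b, a', b', hij, hjl.symm, hil, hC, ha, hb, ha', hb', hab, hab'⟩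
    · contradiction
  · obtain ⟨a', b', hab', ha', hb'⟩ := hout j (by simp [hC])
    rcases hmem b' with hb' | hb' | hb'
    · exact ⟨l, i, j, b, a, a', b', hil.symm, hij.symm, hjl.symm,
        by rw [hC, Finset.pair_comm, Finset.insert_comm], hb, ha, ha', hb', hab.symm, hab'⟩
    · contradiction
    · exact ⟨i, l, j, a, b, a', b', hil, hjl, hij, by rw [hC, Finset.pair_comm], ha, hb, ha', hb',
        hab, hab'⟩

lemma size_eq_two_or_three_le {i : V} (hi : i ∈ F.centres) : F.size i = 2 ∨ 3 ≤ F.size i := by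
  have h := F.two_le_size hi
  unfold size at h ⊢
  norm_cast at h ⊢
  omega

lemma Sk_three_lt [DecidableRel G.Adj] (hG : G.Connected) (ht : F.centres.card = 3)
    (hk : 3 ≤ Fintype.card V) :
    Sk G 3 < 2 * G.edgeFinset.card - Fintype.card V + 6 - 6 / Fintype.card V := by
  obtain ⟨i, j, l, x, y, x', y', hij, hlj, hil, hC, hx, hy, hx', hy', hxy, hxy'⟩ :=
    F.exists_two_edges hG ht
  have hiC : i ∈ F.centres := by simp [hC]
  have hjC : j ∈ F.centres := by simp [hC]
  have hlC : l ∈ F.centres := by simp [hC]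
  have hi := F.two_le_size hiC
  have hj := F.two_le_size hjC
  have hl := F.two_le_size hlC
  have hn : (Fintype.card V : ℝ) = F.size i + F.size j + F.size l := by
    rw [← F.sum_size, hC, Finset.sum_insert (by simp [hij, hil]), Finset.sum_pair hlj.symm,
      add_assoc]
  obtain ⟨γ, hγ⟩ : ∃ γ : ℝ, γ = if y = y' then 1 else 0 := ⟨_, rfl⟩
  have hγ' : γ = 0 ∨ γ = 1 := by rw [hγ]; split_ifs <;> simp
  by_cases h : 3 ≤ F.size i ∧ 3 ≤ F.size j ∧ 3 ≤ F.size l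
  · obtain ⟨h₂₂, hdet, hgain⟩ := three_star_gain_three hi hj hl
      (gainThree_pos hγ' h.1 h.2.1 h.2.2) rfl rfl rfl rfl rfl rfl rfl rfl rfl
    have hSk := F.Sk_le_of_two_edges hij hlj hil hC hx hy hx' hy' hxy hxy' hγ (by norm_num)
      (by
        intro v hv
        rw [hC] at hv
        simp only [Finset.mem_insert, Finset.mem_singleton] at hv
        rcases hv with rfl | rfl | rfl
        exacts [h.1, h.2.1, h.2.2]) rfl rfl rfl rfl rfl rfl rfl rfl rfl h₂₂ hdet hk
    rw [← hn] at hgain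
    linarith
  · have hpos : 0 < gainTwo γ (F.size i) (F.size j) (F.size l) := by
      rcases F.size_eq_two_or_three_le hiC with h₁ | h₁
      · rw [h₁]
        exact gainTwo_pos_of_left hγ' hj hl
      rcases F.size_eq_two_or_three_le hjC with h₂ | h₂
      · rw [h₂]
        exact gainTwo_pos_of_middle hγ' hi hl
      rcases F.size_eq_two_or_three_le hlC with h₃ | h₃
      · rw [h₃, gainTwo_comm]
        exact gainTwo_pos_of_left hγ' hj hi
      · exact absurd ⟨h₁, h₂, h₃⟩ h
    obtain ⟨h₂₂, hdet, hgain⟩ := three_star_gain_two hi hj hl hpos rfl rfl rfl rfl rfl rfl rfl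
      rfl rfl
    have hSk := F.Sk_le_of_two_edges hij hlj hil hC hx hy hx' hy' hxy hxy' hγ one_le_two
      (fun v hv => F.two_le_size hv) rfl rfl rfl rfl rfl rfl rfl rfl rfl h₂₂ hdet hk
    rw [← hn] at hgain
    linarith

end StarForest

/-- For a connected graph `G` with `n ≥ 6` vertices, `e(G)` edges and
diameter at least `4`, we have `S_k(G) < 2 e(G) - n + 2k - 2k/n` for every `1 ≤ k ≤ n`. -/
theorem Sk_lt_of_connected_diam_ge_four {V : Type} [Fintype V] [DecidableEq V]
    (G : SimpleGraph V) [DecidableRel G.Adj] (n : ℕ) (hcard : Fintype.card V = n)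
    (hn : 6 ≤ n) (hconn : G.Connected) (hdiam : 4 ≤ G.diam)
    (k : ℕ) (hk1 : 1 ≤ k) (hkn : k ≤ n) :
    Sk G k < 2 * (G.edgeFinset.card : ℝ) - n + 2 * k - 2 * k / n := by
  subst hcard
  by_cases hM : HasThreeMatching G
  · obtain ⟨a₁, b₁, a₂, b₂, a₃, b₃, h₁, h₂, h₃, hd⟩ := hM
    obtain ⟨F, hF⟩ := exists_starForest_of_matching hconn h₁ h₂ h₃ hd
    by_cases h3 : F.centres.card = 3 ∧ k = 3
    · obtain ⟨ht, rfl⟩ := h3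
      refine (F.Sk_three_lt hconn ht hkn).trans_eq ?_
      norm_num
    · exact F.Sk_lt_of_three_le_card hconn hF hkn h3
  · exact Sk_lt_of_not_hasThreeMatching hconn hn hdiam hM hkn

end LapPaper
end

section
/- Let a ≥ b ≥ 1 be integers and n = a + b + 2. The characteristic polynomial of the Laplacian matrix of the double star T(a,b) is P_{T(a,b)}(x) = p_{a,b}(x) · (x−1)^{n−4} · x, where p_{a,b}(x) = x³ − (a+b+4)x² + (ab+2a+2b+5)x − (a+b+2). -/
open Polynomial

namespace LapPaper

/-- The vertices of the double star, split into the two centres and the leaves at each of them. -/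
def doubleStarEquiv (a b : ℕ) : Fin 2 ⊕ (Fin a ⊕ Fin b) ≃ Fin (a + b + 2) :=
  (((Equiv.refl _).sumCongr finSumFinEquiv).trans finSumFinEquiv).trans (finCongr (by omega))

section Adjacency

variable {a b : ℕ}

theorem doubleStarEquiv_centre_val (i : Fin 2) :
    (doubleStarEquiv a b (.inl i)).val = i.val := rfl

theorem doubleStarEquiv_inl_val (k : Fin a) :
    (doubleStarEquiv a b (.inr (.inl k))).val = 2 + k.val := rfl

theorem doubleStarEquiv_inr_val (k : Fin b) :
    (doubleStarEquiv a b (.inr (.inr k))).val = 2 + (a + k.val) := rfl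

theorem doubleStar_adj_centre_centre (i j : Fin 2) :
    (doubleStar a b).Adj (doubleStarEquiv a b (.inl i)) (doubleStarEquiv a b (.inl j)) ↔
      i ≠ j := by
  simp only [doubleStar, SimpleGraph.fromRel_adj, ne_eq, Fin.ext_iff,
    doubleStarEquiv_centre_val]
  omega

theorem doubleStar_adj_centre_inl (i : Fin 2) (k : Fin a) :
    (doubleStar a b).Adj (doubleStarEquiv a b (.inl i)) (doubleStarEquiv a b (.inr (.inl k))) ↔
      i = 0 := by
  simp only [doubleStar, SimpleGraph.fromRel_adj, ne_eq, Fin.ext_iff, Fin.coe_ofNat_eq_mod,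
    doubleStarEquiv_centre_val, doubleStarEquiv_inl_val]
  omega

theorem doubleStar_adj_centre_inr (i : Fin 2) (k : Fin b) :
    (doubleStar a b).Adj (doubleStarEquiv a b (.inl i)) (doubleStarEquiv a b (.inr (.inr k))) ↔
      i = 1 := by
  simp only [doubleStar, SimpleGraph.fromRel_adj, ne_eq, Fin.ext_iff, Fin.coe_ofNat_eq_mod,
    doubleStarEquiv_centre_val, doubleStarEquiv_inr_val]
  omega

theorem doubleStar_not_adj_leaf_leaf (k l : Fin a ⊕ Fin b) :
    ¬ (doubleStar a b).Adj (doubleStarEquiv a b (.inr k)) (doubleStarEquiv a b (.inr l)) := by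
  rcases k with k | k <;> rcases l with l | l <;>
    simp only [doubleStar, SimpleGraph.fromRel_adj, ne_eq, Fin.ext_iff,
      doubleStarEquiv_inl_val, doubleStarEquiv_inr_val] <;>
    omega

theorem doubleStar_adj_inl_centre (i : Fin 2) (k : Fin a) :
    (doubleStar a b).Adj (doubleStarEquiv a b (.inr (.inl k))) (doubleStarEquiv a b (.inl i)) ↔
      i = 0 := by
  rw [SimpleGraph.adj_comm, doubleStar_adj_centre_inl]

theorem doubleStar_adj_inr_centre (i : Fin 2) (k : Fin b) :
    (doubleStar a b).Adj (doubleStarEquiv a b (.inr (.inr k))) (doubleStarEquiv a b (.inl i)) ↔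
      i = 1 := by
  rw [SimpleGraph.adj_comm, doubleStar_adj_centre_inr]

end Adjacency

theorem degree_doubleStar_eq_sum (a b : ℕ) (u : Fin (a + b + 2)) :
    ((doubleStar a b).degree u : ℝ) =
      ((if (doubleStar a b).Adj u (doubleStarEquiv a b (.inl 0)) then 1 else 0) +
        if (doubleStar a b).Adj u (doubleStarEquiv a b (.inl 1)) then 1 else 0) +
      ((∑ k, if (doubleStar a b).Adj u (doubleStarEquiv a b (.inr (.inl k))) then 1 else 0) +
        ∑ k, if (doubleStar a b).Adj u (doubleStarEquiv a b (.inr (.inr k))) then 1 else 0) := by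
  rw [← Fin.sum_univ_two fun i =>
      if (doubleStar a b).Adj u (doubleStarEquiv a b (.inl i)) then (1 : ℝ) else 0,
    ← Fintype.sum_sum_type fun k =>
      if (doubleStar a b).Adj u (doubleStarEquiv a b (.inr k)) then (1 : ℝ) else 0,
    ← Fintype.sum_sum_type fun v =>
      if (doubleStar a b).Adj u (doubleStarEquiv a b v) then (1 : ℝ) else 0,
    (doubleStarEquiv a b).sum_comp (fun v => if (doubleStar a b).Adj u v then (1 : ℝ) else 0),
    ← SimpleGraph.card_neighborFinset_eq_degree, SimpleGraph.neighborFinset_eq_filter]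
  simp

/-- The adjacency matrix between the two centres and the leaves. -/
def centreLeafMatrix (a b : ℕ) : Matrix (Fin 2) (Fin a ⊕ Fin b) ℝ :=
  Matrix.of ![Sum.elim 1 0, Sum.elim 0 1]

/-- The block form of `x • 1 - L` for the double star. -/
theorem submatrix_scalar_sub_lapMatrix_doubleStar (a b : ℕ) (x : ℝ) :
    (Matrix.scalar _ x - (doubleStar a b).lapMatrix ℝ).submatrix
        (doubleStarEquiv a b) (doubleStarEquiv a b) =
      Matrix.fromBlocks !![x - (a + 1), 1; 1, x - (b + 1)] (centreLeafMatrix a b)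
        (centreLeafMatrix a b).transpose (Matrix.diagonal fun _ => x - 1) := by
  ext u v
  rcases u with u | u | u <;> rcases v with v | v | v <;> (try fin_cases u) <;>
    (try fin_cases v) <;>
    simp [SimpleGraph.lapMatrix, SimpleGraph.degMatrix, Matrix.diagonal_apply,
      degree_doubleStar_eq_sum, centreLeafMatrix, doubleStar_adj_centre_centre,
      doubleStar_adj_centre_inl, doubleStar_adj_centre_inr, doubleStar_not_adj_leaf_leaf,
      doubleStar_adj_inl_centre, doubleStar_adj_inr_centre]
  · exact add_comm _ _
  · exact add_comm _ _
  · split_ifs <;> simp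
  · split_ifs <;> simp

theorem centreLeafMatrix_mul_diagonal_mul_transpose (a b : ℕ) (y : ℝ) :
    centreLeafMatrix a b *
        (Matrix.diagonal fun _ => y : Matrix (Fin a ⊕ Fin b) (Fin a ⊕ Fin b) ℝ) *
        (centreLeafMatrix a b).transpose =
      !![a * y, 0; 0, b * y] := by
  ext i j
  rw [Matrix.mul_apply]
  fin_cases i <;> fin_cases j <;> simp [centreLeafMatrix, Matrix.mul_diagonal]

theorem det_scalar_sub_lapMatrix_doubleStar (a b : ℕ) {x : ℝ} (hx : x - 1 ≠ 0) :
    (Matrix.scalar _ x - (doubleStar a b).lapMatrix ℝ).det =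
      (x - 1) ^ (a + b) *
        ((x - (a + 1) - a / (x - 1)) * (x - (b + 1) - b / (x - 1)) - 1) := by
  let D : Matrix (Fin a ⊕ Fin b) (Fin a ⊕ Fin b) ℝ := Matrix.diagonal fun _ => x - 1
  let : Invertible D := ⟨Matrix.diagonal fun _ => (x - 1)⁻¹, by simp [D, hx], by simp [D, hx]⟩
  have hD : ⅟D = Matrix.diagonal fun _ => (x - 1)⁻¹ := rfl
  rw [← Matrix.det_submatrix_equiv_self (doubleStarEquiv a b),
    submatrix_scalar_sub_lapMatrix_doubleStar, Matrix.det_fromBlocks₂₂ (D := D), hD,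
    centreLeafMatrix_mul_diagonal_mul_transpose]
  simp [D, Matrix.det_fin_two, div_eq_mul_inv]

/-- For integers `a ≥ b ≥ 1` and `n = a + b + 2`, the characteristic
polynomial of the Laplacian matrix of the double star `T(a,b)` is
`p_{a,b}(x) · (x - 1)^(n-4) · x`, where
`p_{a,b}(x) = x³ - (a+b+4)x² + (ab+2a+2b+5)x - (a+b+2)`. -/
theorem charpoly_doubleStar (a b : ℕ) (hab : b ≤ a) (hb : 1 ≤ b) :
    ((doubleStar a b).lapMatrix ℝ).charpoly =
      (X ^ 3 - C ((a : ℝ) + b + 4) * X ^ 2 + C ((a : ℝ) * b + 2 * a + 2 * b + 5) * X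
          - C ((a : ℝ) + b + 2)) *
        (X - 1) ^ (a + b + 2 - 4) * X := by
  obtain ⟨m, hm⟩ : ∃ m, a + b = m + 2 := ⟨a + b - 2, by omega⟩
  refine Polynomial.eq_of_infinite_eval_eq _ _
    ((Set.finite_singleton (1 : ℝ)).infinite_compl.mono fun x hx => ?_)
  have hx : x - 1 ≠ 0 := sub_ne_zero.mpr hx
  rw [Set.mem_ofPred_eq, Matrix.eval_charpoly, det_scalar_sub_lapMatrix_doubleStar a b hx, hm,
    show m + 2 + 2 - 4 = m by omega]
  simp only [eval_mul, eval_sub, eval_add, eval_pow, eval_X, eval_C, eval_one]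
  field_simp
  ring

end LapPaper
end
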